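/- arXiv:1503.04826 — 3 statements merged into one kernel-verified Lean document; each statement's English description precedes it below -/
import Mathlib

section
/- There exists ε₀ > 0 such that for every 0 < ε < ε₀ the regularized interaction energy E_ε admits a minimizer over P_2(ℝ^d): there exists μ_ε ∈ P_2(ℝ^d) such that E_ε(μ_ε) ≤ E_ε(ν) for all ν ∈ P_2(ℝ^d). -/
open MeasureTheory Filter
open scoped ENNReal Topology NNReal

noncomputable section

/-- Power-law interaction kernel `K(x) = |x|^q/q - |x|^p/p` (real-valued). -/
noncomputable def Kfun (d : ℕ) (p q : ℝ) (x : EuclideanSpace ℝ (Fin d)) : ℝ :=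
  ‖x‖ ^ q / q - ‖x‖ ^ p / p

/-- Power-law interaction kernel, valued in `[0,∞]` (note `K 0 = ∞` when `p < 0 < q`). -/
noncomputable def KE (d : ℕ) (p q : ℝ) (x : EuclideanSpace ℝ (Fin d)) : ℝ≥0∞ :=
  (‖x‖₊ : ℝ≥0∞) ^ q / ENNReal.ofReal q + (‖x‖₊ : ℝ≥0∞) ^ p / ENNReal.ofReal (-p)

/-- Repulsive part `K^r(x) = -|x|^p/p` of the power-law kernel, valued in `[0,∞]`. -/
noncomputable def KrE (d : ℕ) (p : ℝ) (x : EuclideanSpace ℝ (Fin d)) : ℝ≥0∞ :=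
  (‖x‖₊ : ℝ≥0∞) ^ p / ENNReal.ofReal (-p)

/-- Rescaled mollifier `φ_ε(x) = ε^{-d} φ(x/ε)`. -/
noncomputable def scaled (d : ℕ) (φ : EuclideanSpace ℝ (Fin d) → ℝ) (ε : ℝ)
    (x : EuclideanSpace ℝ (Fin d)) : ℝ :=
  (ε ^ d)⁻¹ * φ (ε⁻¹ • x)

/-- Mollifier hypotheses (M1)–(M3). -/
def IsMollifier (d : ℕ) (φ : EuclideanSpace ℝ (Fin d) → ℝ) : Prop :=
  ContDiff ℝ (⊤ : ℕ∞) φ ∧ (∀ x y, ‖x‖ = ‖y‖ → φ x = φ y) ∧ (∀ x, 0 ≤ φ x) ∧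
    (∫ x, φ x) = 1 ∧
    ∃ C : ℝ, 0 < C ∧ ∃ l : ℝ, max (2 * (d : ℝ) + 1) 4 ≤ l ∧
      ∀ x : EuclideanSpace ℝ (Fin d), x ≠ 0 → φ x ≤ C * ‖x‖ ^ (-l)

/-- Regularized kernel `K_ε = φ_ε * K * φ_ε` (real-valued). -/
noncomputable def Kreg (d : ℕ) (p q : ℝ) (φ : EuclideanSpace ℝ (Fin d) → ℝ) (ε : ℝ)
    (x : EuclideanSpace ℝ (Fin d)) : ℝ :=
  ∫ y, ∫ z, scaled d φ ε y * Kfun d p q (x - y - z) * scaled d φ ε z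

/-- Double mollification `g * K * g` of a `[0,∞]`-valued kernel by a nonnegative function. -/
noncomputable def convE (d : ℕ) (g : EuclideanSpace ℝ (Fin d) → ℝ)
    (K : EuclideanSpace ℝ (Fin d) → ℝ≥0∞) (x : EuclideanSpace ℝ (Fin d)) : ℝ≥0∞ :=
  ∫⁻ y, ∫⁻ z, ENNReal.ofReal (g y) * K (x - y - z) * ENNReal.ofReal (g z)

/-- Interaction energy `E(μ) = ∬ K(x-y) dμ(x) dμ(y)` for a `[0,∞]`-valued kernel. -/
noncomputable def energyE (d : ℕ) (K : EuclideanSpace ℝ (Fin d) → ℝ≥0∞)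
    (μ : Measure (EuclideanSpace ℝ (Fin d))) : ℝ≥0∞ :=
  ∫⁻ x, ∫⁻ y, K (x - y) ∂μ ∂μ

/-- Regularized interaction energy `E_ε(μ) = ∬ K_ε(x-y) dμ(x) dμ(y)`. -/
noncomputable def energyReg (d : ℕ) (p q : ℝ) (φ : EuclideanSpace ℝ (Fin d) → ℝ) (ε : ℝ)
    (μ : Measure (EuclideanSpace ℝ (Fin d))) : ℝ≥0∞ :=
  energyE d (fun x => ENNReal.ofReal (Kreg d p q φ ε x)) μ

/-- Real-valued interaction energy. -/
noncomputable def energyReal (d : ℕ) (p q : ℝ) (μ : Measure (EuclideanSpace ℝ (Fin d))) : ℝ :=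
  ∫ x, ∫ y, Kfun d p q (x - y) ∂μ ∂μ

/-- Borel probability measure with finite second moment. -/
def IsP2 (d : ℕ) (μ : Measure (EuclideanSpace ℝ (Fin d))) : Prop :=
  IsProbabilityMeasure μ ∧ (∫⁻ x, (‖x‖₊ : ℝ≥0∞) ^ 2 ∂μ) < ⊤

/-- The heat kernel `ψ_ε(x) = (4πε)^{-d/2} e^{-|x|²/(4ε)}`. -/
noncomputable def heat (d : ℕ) (ε : ℝ) (x : EuclideanSpace ℝ (Fin d)) : ℝ :=
  (4 * Real.pi * ε) ^ (-(d : ℝ) / 2) * Real.exp (-‖x‖ ^ 2 / (4 * ε))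

/-- Weak-* convergence of a sequence of measures: convergence of integrals of all bounded
continuous functions. -/
def WeakStarTendsto (d : ℕ) (μ : ℕ → Measure (EuclideanSpace ℝ (Fin d)))
    (ν : Measure (EuclideanSpace ℝ (Fin d))) : Prop :=
  ∀ f : EuclideanSpace ℝ (Fin d) → ℝ, Continuous f → (∃ M : ℝ, ∀ x, |f x| ≤ M) →
    Tendsto (fun k => ∫ x, f x ∂(μ k)) atTop (𝓝 (∫ x, f x ∂ν))

/-- `μ` is absolutely continuous (w.r.t. Lebesgue) with density bounded by `R`. -/
def HasBddDensity (d : ℕ) (μ : Measure (EuclideanSpace ℝ (Fin d))) (R : ℝ) : Prop :=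
  ∃ ρ : EuclideanSpace ℝ (Fin d) → ℝ≥0∞, Measurable ρ ∧ μ = volume.withDensity ρ ∧
    ∀ᵐ x ∂(volume : Measure (EuclideanSpace ℝ (Fin d))), ρ x ≤ ENNReal.ofReal R

/-- Explicit gradient `∇K(x) = x|x|^{q-2} - x|x|^{p-2}` of the power-law kernel. -/
noncomputable def gradK (d : ℕ) (p q : ℝ) (x : EuclideanSpace ℝ (Fin d)) :
    EuclideanSpace ℝ (Fin d) :=
  (‖x‖ ^ (q - 2)) • x - (‖x‖ ^ (p - 2)) • x

/-- The log-Lipschitz modulus of convexity `ω`. -/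
noncomputable def omegaMod (x : ℝ) : ℝ :=
  if x ≤ Real.exp (-1 - Real.sqrt 2) then x * |Real.log x|
  else Real.sqrt (x ^ 2 + 2 * (1 + Real.sqrt 2) * Real.exp (-1 - Real.sqrt 2) * x)

/-- Support of a measure: points all of whose neighborhoods have positive measure. -/
def msupport (d : ℕ) (μ : Measure (EuclideanSpace ℝ (Fin d))) :
    Set (EuclideanSpace ℝ (Fin d)) :=
  {x | ∀ r : ℝ, 0 < r → 0 < μ (Metric.ball x r)}

/-- The measure `μ * ψ_δ` obtained by mollifying `μ` with the heat kernel at scale `δ`. -/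
noncomputable def heatMollified (d : ℕ) (μ : Measure (EuclideanSpace ℝ (Fin d))) (δ : ℝ) :
    Measure (EuclideanSpace ℝ (Fin d)) :=
  volume.withDensity fun x => ENNReal.ofReal (∫ y, heat d δ (x - y) ∂μ)

lemma aux_meas {d : ℕ} {k : EuclideanSpace ℝ (Fin d) → ℝ≥0∞} (hk : Measurable k) :
    Measurable (fun z : EuclideanSpace ℝ (Fin d) × EuclideanSpace ℝ (Fin d) => k (z.1 - z.2)) :=
  hk.comp (measurable_fst.sub measurable_snd)

lemma aux_measV {d : ℕ} {k : EuclideanSpace ℝ (Fin d) → ℝ≥0∞} (hk : Measurable k)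
    (μ : Measure (EuclideanSpace ℝ (Fin d))) [SFinite μ] :
    Measurable (fun x => ∫⁻ y, k (x - y) ∂μ) :=
  Measurable.lintegral_prod_right (aux_meas hk)

/-- Lower semicontinuity of the energy for a continuous kernel. -/
lemma energy_lsc {d : ℕ} {h : EuclideanSpace ℝ (Fin d) → ℝ} (hc : Continuous h) :
    LowerSemicontinuous (fun μ : ProbabilityMeasure (EuclideanSpace ℝ (Fin d)) =>
      energyE d (fun x => ENNReal.ofReal (h x)) (μ : Measure (EuclideanSpace ℝ (Fin d)))) := by
  have hcN : ∀ N : ℕ, Continuous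
      (fun z : EuclideanSpace ℝ (Fin d) × EuclideanSpace ℝ (Fin d) =>
        min (h (z.1 - z.2)).toNNReal (N : ℝ≥0)) := fun N =>
    (continuous_real_toNNReal.comp (hc.comp (continuous_fst.sub continuous_snd))).min
      continuous_const
  let f : ℕ → BoundedContinuousFunction
      (EuclideanSpace ℝ (Fin d) × EuclideanSpace ℝ (Fin d)) ℝ≥0 := fun N =>
    BoundedContinuousFunction.mkOfBound ⟨_, hcN N⟩ N (by
      intro x y
      simp only [ContinuousMap.coe_mk]
      rw [NNReal.dist_eq, abs_le]
      have h1 : ((min (h (x.1 - x.2)).toNNReal (N : ℝ≥0) : ℝ≥0) : ℝ) ≤ N := by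
        exact_mod_cast min_le_right _ _
      have h2 : ((min (h (y.1 - y.2)).toNNReal (N : ℝ≥0) : ℝ≥0) : ℝ) ≤ N := by
        exact_mod_cast min_le_right _ _
      have h3 := (min (h (x.1 - x.2)).toNNReal (N : ℝ≥0)).coe_nonneg
      have h4 := (min (h (y.1 - y.2)).toNNReal (N : ℝ≥0)).coe_nonneg
      constructor <;> linarith)
  have key : (fun μ : ProbabilityMeasure (EuclideanSpace ℝ (Fin d)) =>
      energyE d (fun x => ENNReal.ofReal (h x)) (μ : Measure (EuclideanSpace ℝ (Fin d)))) =
      fun μ => ⨆ N : ℕ, ∫⁻ z, (f N z : ℝ≥0∞) ∂((μ.prod μ : ProbabilityMeasure _) :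
        Measure (EuclideanSpace ℝ (Fin d) × EuclideanSpace ℝ (Fin d))) := by
    funext μ
    rw [← lintegral_iSup]
    · unfold energyE
      rw [ProbabilityMeasure.toMeasure_prod, lintegral_prod]
      · refine lintegral_congr fun x => lintegral_congr fun y => ?_
        apply le_antisymm
        · obtain ⟨N, hN⟩ := exists_nat_ge (h (x - y)).toNNReal
          refine le_trans ?_ (le_iSup _ N)
          simp only [f, BoundedContinuousFunction.mkOfBound_coe, ContinuousMap.coe_mk]
          rw [min_eq_left hN]
          rfl
        · refine iSup_le fun N => ?_
          simp only [f, BoundedContinuousFunction.mkOfBound_coe, ContinuousMap.coe_mk]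
          exact ENNReal.coe_le_coe.2 (min_le_left _ _)
      · exact (Measurable.iSup fun N =>
          ((f N).continuous.measurable.coe_nnreal_ennreal)).aemeasurable
    · exact fun N => (f N).continuous.measurable.coe_nnreal_ennreal
    · intro N M hNM z
      simp only [f, BoundedContinuousFunction.mkOfBound_coe, ContinuousMap.coe_mk]
      exact ENNReal.coe_le_coe.2 (min_le_min le_rfl (by exact_mod_cast hNM))
  rw [key]
  refine lowerSemicontinuous_iSup fun N => Continuous.lowerSemicontinuous ?_
  have : Continuous (fun μ : ProbabilityMeasure (EuclideanSpace ℝ (Fin d)) => μ.prod μ) :=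
    ProbabilityMeasure.continuous_prod.comp (continuous_id.prodMk continuous_id)
  exact ProbabilityMeasure.continuous_iff_forall_continuous_lintegral.1 this (f N)

/-- Compact support of minimizers among all probability measures. -/
lemma min_support {d : ℕ} {h : EuclideanSpace ℝ (Fin d) → ℝ} (hc : Continuous h)
    (hco : ∀ T : ℝ, ∃ R : ℝ, ∀ x, R ≤ ‖x‖ → T ≤ h x)
    (μ : Measure (EuclideanSpace ℝ (Fin d))) [IsProbabilityMeasure μ]
    (hfin : energyE d (fun x => ENNReal.ofReal (h x)) μ ≠ ⊤)
    (hmin : ∀ ν : Measure (EuclideanSpace ℝ (Fin d)), IsProbabilityMeasure ν →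
      energyE d (fun x => ENNReal.ofReal (h x)) μ ≤ energyE d (fun x => ENNReal.ofReal (h x)) ν) :
    ∃ R : ℝ, μ (Metric.closedBall 0 R)ᶜ = 0 := by
  have hk : Measurable (fun x => ENNReal.ofReal (h x)) := hc.measurable.ennreal_ofReal
  set k : EuclideanSpace ℝ (Fin d) → ℝ≥0∞ := fun x => ENNReal.ofReal (h x) with hkdef
  set e := energyE d k μ with he
  obtain ⟨n, hn⟩ : ∃ n : ℕ, 0 < μ (Metric.closedBall 0 (n : ℝ)) := by
    by_contra! hcon
    have : μ Set.univ = 0 := by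
      rw [← Metric.iUnion_closedBall_nat (0 : EuclideanSpace ℝ (Fin d))]
      exact measure_iUnion_null fun n => le_antisymm (hcon n) zero_le
    simp at this
  set a := μ (Metric.closedBall 0 (n : ℝ)) with ha
  have hafin : a ≠ ⊤ := measure_ne_top _ _
  obtain ⟨R2, hR2⟩ := hco ((2 * e + 1) / a).toReal
  have hTfin : (2 * e + 1) / a ≠ ⊤ :=
    (ENNReal.div_lt_top (by finiteness) hn.ne').ne
  refine ⟨n + R2, ?_⟩
  set B := Metric.closedBall (0 : EuclideanSpace ℝ (Fin d)) (n + R2) with hB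
  have hBm : MeasurableSet B := Metric.isClosed_closedBall.measurableSet
  have hV : ∀ x ∈ Bᶜ, 2 * e + 1 ≤ ∫⁻ y, k (x - y) ∂μ := by
    intro x hx
    have hx' : n + R2 < ‖x‖ := by
      simpa [hB] using hx
    calc 2 * e + 1 = (2 * e + 1) / a * a := (ENNReal.div_mul_cancel hn.ne' hafin).symm
      _ = ∫⁻ y in Metric.closedBall 0 (n : ℝ), (2 * e + 1) / a ∂μ := by
        rw [setLIntegral_const]
      _ ≤ ∫⁻ y in Metric.closedBall 0 (n : ℝ), k (x - y) ∂μ := by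
        refine setLIntegral_mono (hk.comp (measurable_const.sub measurable_id)) fun y hy => ?_
        rw [← ENNReal.ofReal_toReal hTfin]
        apply ENNReal.ofReal_le_ofReal
        apply hR2
        have hy' : ‖y‖ ≤ n := by simpa using hy
        have := norm_sub_norm_le x y
        linarith
      _ ≤ _ := setLIntegral_le_lintegral _ _
  have h1 : (2 * e + 1) * μ Bᶜ ≤ ∫⁻ x in Bᶜ, ∫⁻ y, k (x - y) ∂μ ∂μ := by
    rw [← setLIntegral_const]
    exact setLIntegral_mono (aux_measV hk μ) hV
  have h2 : energyE d k (μ.restrict B) ≤ ∫⁻ x in B, ∫⁻ y, k (x - y) ∂μ ∂μ := by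
    unfold energyE
    exact lintegral_mono fun x => setLIntegral_le_lintegral _ _
  have h3 : μ B * μ B * e ≤ energyE d k (μ.restrict B) := by
    by_cases hb : μ B = 0
    · simp [hb]
    have hbt : μ B ≠ ⊤ := measure_ne_top _ _
    have hp : IsProbabilityMeasure ((μ B)⁻¹ • μ.restrict B) := by
      constructor
      simp [ENNReal.inv_mul_cancel hb hbt]
    have h4 := hmin _ hp
    have h5 : energyE d k ((μ B)⁻¹ • μ.restrict B) =
        (μ B)⁻¹ * ((μ B)⁻¹ * energyE d k (μ.restrict B)) := by
      unfold energyE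
      simp only [lintegral_smul_measure, smul_eq_mul]
      rw [lintegral_const_mul _ (aux_measV hk _)]
    rw [h5] at h4
    calc μ B * μ B * e ≤ μ B * μ B * ((μ B)⁻¹ * ((μ B)⁻¹ * energyE d k (μ.restrict B))) := by
          gcongr
      _ = (μ B * (μ B)⁻¹) * ((μ B) * (μ B)⁻¹) * energyE d k (μ.restrict B) := by ring
      _ = _ := by rw [ENNReal.mul_inv_cancel hb hbt]; simp
  have h6 : (2 * e + 1) * μ Bᶜ + μ B * μ B * e ≤ e := by
    calc _ ≤ (∫⁻ x in Bᶜ, ∫⁻ y, k (x - y) ∂μ ∂μ) + ∫⁻ x in B, ∫⁻ y, k (x - y) ∂μ ∂μ :=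
          add_le_add h1 (h3.trans h2)
      _ = e := by
        rw [add_comm, lintegral_add_compl _ hBm, he, energyE]
  have h7 : μ B + μ Bᶜ = 1 := by rw [measure_add_measure_compl hBm, measure_univ]
  have hm : μ Bᶜ ≠ ⊤ := measure_ne_top _ _
  have hb : μ B ≠ ⊤ := measure_ne_top _ _
  generalize μ Bᶜ = m at *
  generalize μ B = b at *
  clear_value e
  lift e to ℝ≥0 using hfin
  lift m to ℝ≥0 using hm
  lift b to ℝ≥0 using hb
  have h6' : (2 * e + 1) * m + b * b * e ≤ e := by exact_mod_cast h6
  have h7' : b + m = 1 := by exact_mod_cast h7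
  have h6r : (2 * (e : ℝ) + 1) * m + b * b * e ≤ e := by exact_mod_cast h6'
  have h7r : (b : ℝ) + m = 1 := by exact_mod_cast h7'
  have hb' : (b : ℝ) = 1 - m := by linarith
  rw [hb'] at h6r
  have : (m : ℝ) ≤ 0 := by
    have := mul_nonneg (mul_nonneg m.coe_nonneg m.coe_nonneg) e.coe_nonneg
    nlinarith
  have : (m : ℝ) = 0 := le_antisymm this m.coe_nonneg
  exact_mod_cast this

lemma energy_translate {d : ℕ} {k : EuclideanSpace ℝ (Fin d) → ℝ≥0∞} (hk : Measurable k)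
    (ν : Measure (EuclideanSpace ℝ (Fin d))) [SFinite ν] (c : EuclideanSpace ℝ (Fin d)) :
    energyE d k (ν.map (fun x => x - c)) = energyE d k ν := by
  have hm : Measurable (fun x : EuclideanSpace ℝ (Fin d) => x - c) := by fun_prop
  unfold energyE
  rw [lintegral_map (aux_measV hk _) hm]
  refine lintegral_congr fun x => ?_
  have hm2 : Measurable (fun y => k (x - c - y)) := hk.comp (measurable_const.sub measurable_id)
  rw [lintegral_map hm2 hm]
  simp

/-- Abstract existence result. -/
theorem exists_min_of_coercive {d : ℕ} {h : EuclideanSpace ℝ (Fin d) → ℝ} (hc : Continuous h)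
    (hco : ∀ T : ℝ, ∃ R : ℝ, ∀ x, R ≤ ‖x‖ → T ≤ h x) :
    ∃ μ : Measure (EuclideanSpace ℝ (Fin d)), IsP2 d μ ∧
      ∀ ν : Measure (EuclideanSpace ℝ (Fin d)), IsP2 d ν →
        energyE d (fun x => ENNReal.ofReal (h x)) μ ≤
          energyE d (fun x => ENNReal.ofReal (h x)) ν := by
  have hk : Measurable (fun x => ENNReal.ofReal (h x)) := hc.measurable.ennreal_ofReal
  set k : EuclideanSpace ℝ (Fin d) → ℝ≥0∞ := fun x => ENNReal.ofReal (h x) with hkdef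
  have hkm : Measurable (fun y => k (0 - y)) := hk.comp (measurable_const.sub measurable_id)
  let S : Set (ProbabilityMeasure (EuclideanSpace ℝ (Fin d))) :=
    {μ | ∫⁻ y, k (0 - y) ∂(μ : Measure (EuclideanSpace ℝ (Fin d))) ≤ k 0}
  have htight : IsTightMeasureSet
      {((μ : ProbabilityMeasure (EuclideanSpace ℝ (Fin d))) :
        Measure (EuclideanSpace ℝ (Fin d))) | μ ∈ S} := by
    rw [isTightMeasureSet_iff_exists_isCompact_measure_compl_le]
    intro δ hδ
    obtain ⟨T, hT⟩ : ∃ T : ℝ≥0, T ≠ 0 ∧ k 0 / T ≤ δ := by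
      by_cases hδt : δ = ⊤
      · exact ⟨1, one_ne_zero, by simp [hδt]⟩
      have hne : k 0 / δ ≠ ⊤ := (ENNReal.div_lt_top ENNReal.ofReal_ne_top hδ.ne').ne
      refine ⟨(k 0 / δ).toNNReal + 1, by positivity, ?_⟩
      apply ENNReal.div_le_of_le_mul
      rw [ENNReal.coe_add, ENNReal.coe_toNNReal hne, mul_add]
      refine le_trans ?_ le_self_add
      rw [ENNReal.mul_div_cancel hδ.ne' hδt]
    obtain ⟨R, hR⟩ := hco T
    refine ⟨Metric.closedBall 0 R, isCompact_closedBall _ _, ?_⟩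
    rintro _ ⟨μ, hμ, rfl⟩
    refine le_trans ?_ hT.2
    rw [ENNReal.le_div_iff_mul_le (Or.inl (by exact_mod_cast hT.1)) (Or.inl ENNReal.coe_ne_top),
      mul_comm]
    refine le_trans ?_ (show _ ≤ k 0 from hμ)
    refine le_trans ?_ (mul_meas_ge_le_lintegral hkm (T : ℝ≥0∞))
    gcongr
    intro y hy
    have hy' : R < ‖y‖ := by simpa using hy
    have := hR (0 - y) (by simpa using hy'.le)
    rw [← ENNReal.ofReal_coe_nnreal]
    exact ENNReal.ofReal_le_ofReal this
  have hcomp := isCompact_closure_of_isTightMeasureSet htight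
  let δ0 : ProbabilityMeasure (EuclideanSpace ℝ (Fin d)) :=
    ⟨Measure.dirac 0, inferInstance⟩
  have hδ0 : δ0 ∈ S := by
    change ∫⁻ y, k (0 - y) ∂(Measure.dirac 0) ≤ k 0
    rw [lintegral_dirac' _ hkm]; simp
  have hδe : energyE d k (δ0 : Measure (EuclideanSpace ℝ (Fin d))) = k 0 := by
    change energyE d k (Measure.dirac 0) = k 0
    unfold energyE
    rw [lintegral_dirac' _ (aux_measV hk _), lintegral_dirac' _ hkm]; simp
  obtain ⟨μ, hμS, hμ⟩ := LowerSemicontinuousOn.exists_isMinOn ⟨δ0, subset_closure hδ0⟩ hcomp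
    ((energy_lsc hc).lowerSemicontinuousOn _)
  have hμ0 : energyE d k (μ : Measure (EuclideanSpace ℝ (Fin d))) ≤ k 0 := by
    rw [← hδe]; exact hμ (subset_closure hδ0)
  have hmin : ∀ ν : Measure (EuclideanSpace ℝ (Fin d)), IsProbabilityMeasure ν →
      energyE d k (μ : Measure (EuclideanSpace ℝ (Fin d))) ≤ energyE d k ν := by
    intro ν hν
    by_cases hle : energyE d k ν ≤ k 0
    · obtain ⟨c, hcc⟩ := exists_le_lintegral (μ := ν) (aux_measV hk ν).aemeasurable
      have hm : Measurable (fun x : EuclideanSpace ℝ (Fin d) => x - c) := by fun_prop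
      let ν' : ProbabilityMeasure (EuclideanSpace ℝ (Fin d)) :=
        ⟨ν.map (fun x => x - c), Measure.isProbabilityMeasure_map hm.aemeasurable⟩
      have hν' : ν' ∈ S := by
        change ∫⁻ y, k (0 - y) ∂(ν.map (fun x => x - c)) ≤ k 0
        rw [lintegral_map hkm hm]
        simp only [zero_sub, neg_sub]
        exact hcc.trans hle
      rw [← energy_translate hk ν c]
      exact hμ (subset_closure hν')
    · exact hμ0.trans (not_le.1 hle).le
  obtain ⟨R, hR⟩ := min_support hc hco (μ : Measure (EuclideanSpace ℝ (Fin d)))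
    (ne_top_of_le_ne_top ENNReal.ofReal_ne_top hμ0) hmin
  refine ⟨μ, ⟨inferInstance, ?_⟩, fun ν hν => hmin ν hν.1⟩
  have hae : ∀ᵐ x ∂(μ : Measure (EuclideanSpace ℝ (Fin d))),
      (‖x‖₊ : ℝ≥0∞) ^ 2 ≤ ENNReal.ofReal R ^ 2 := by
    have : ∀ᵐ x ∂(μ : Measure (EuclideanSpace ℝ (Fin d))), x ∈ Metric.closedBall 0 R := hR
    filter_upwards [this] with x hx
    gcongr
    rw [← ENNReal.ofReal_coe_nnreal]
    exact ENNReal.ofReal_le_ofReal (by simpa using hx)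
  refine lt_of_le_of_lt (lintegral_mono_ae hae) ?_
  simp

lemma weight_integrable {d : ℕ} (hd : 3 ≤ d) :
    Integrable (fun z : EuclideanSpace ℝ (Fin d) =>
      (1 + ‖z‖) ^ 2 * (1 + ‖z‖) ^ (-(2 * (d : ℝ) + 1))) := by
  have hd' : (3 : ℝ) ≤ d := by exact_mod_cast hd
  have h := integrable_one_add_norm (E := EuclideanSpace ℝ (Fin d)) (μ := volume)
    (r := 2 * (d : ℝ) - 1) (by rw [finrank_euclideanSpace_fin]; linarith)
  refine h.congr (Eventually.of_forall fun z => ?_)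
  have hz : 0 < 1 + ‖z‖ := by positivity
  change (1 + ‖z‖) ^ (-(2 * (d : ℝ) - 1)) = (1 + ‖z‖) ^ 2 * (1 + ‖z‖) ^ (-(2 * (d : ℝ) + 1))
  rw [← Real.rpow_natCast, ← Real.rpow_add hz]
  congr 1
  push_cast
  ring

lemma weight_le_one {d : ℕ} (z : EuclideanSpace ℝ (Fin d)) :
    (1 + ‖z‖) ^ (-(2 * (d : ℝ) + 1)) ≤ 1 := by
  apply Real.rpow_le_one_of_one_le_of_nonpos
  · linarith [norm_nonneg z]
  · have : (0 : ℝ) ≤ d := Nat.cast_nonneg d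
    linarith

lemma peetre {d : ℕ} (x z : EuclideanSpace ℝ (Fin d)) :
    1 + ‖x - z‖ ≤ (1 + ‖x‖) * (1 + ‖z‖) := by
  have := norm_sub_le x z
  nlinarith [norm_nonneg x, norm_nonneg z, mul_nonneg (norm_nonneg x) (norm_nonneg z)]

lemma conv_integrable {d : ℕ} (hd : 3 ≤ d) {F k0 g : EuclideanSpace ℝ (Fin d) → ℝ} {c C : ℝ}
    (hFm : Measurable F) (hF0 : ∀ v, 0 ≤ F v) (hk0 : Integrable k0)
    (hk00 : ∀ v, 0 ≤ k0 v) (hc : 0 ≤ c) (hFb : ∀ v, F v ≤ k0 v + c * (1 + ‖v‖) ^ 2)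
    (hgc : Continuous g) (hg0 : ∀ v, 0 ≤ g v) (hC : 0 ≤ C)
    (hgb : ∀ v, g v ≤ C * (1 + ‖v‖) ^ (-(2 * (d : ℝ) + 1))) (x : EuclideanSpace ℝ (Fin d)) :
    Integrable (fun z => F (x - z) * g z) ∧
      ∫ z, F (x - z) * g z ≤ (C * (∫ z, k0 z) + c * C * ∫ z : EuclideanSpace ℝ (Fin d),
      (1 + ‖z‖) ^ 2 * (1 + ‖z‖) ^ (-(2 * (d : ℝ) + 1))) * (1 + ‖x‖) ^ 2 := by
  have hW := weight_integrable hd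
  have hkx : Integrable (fun z => k0 (x - z)) := hk0.comp_sub_left x
  have hbi : Integrable (fun z : EuclideanSpace ℝ (Fin d) => C * k0 (x - z) +
      c * C * (1 + ‖x‖) ^ 2 * ((1 + ‖z‖) ^ 2 * (1 + ‖z‖) ^ (-(2 * (d : ℝ) + 1)))) :=
    (hkx.const_mul C).add (hW.const_mul _)
  have hb : ∀ z, F (x - z) * g z ≤ C * k0 (x - z) +
      c * C * (1 + ‖x‖) ^ 2 * ((1 + ‖z‖) ^ 2 * (1 + ‖z‖) ^ (-(2 * (d : ℝ) + 1))) := by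
    intro z
    have hw0 : 0 ≤ (1 + ‖z‖) ^ (-(2 * (d : ℝ) + 1)) := by positivity
    have h1 : g z ≤ C := (hgb z).trans (by
      have := mul_le_mul_of_nonneg_left (weight_le_one z) hC
      linarith)
    have h2 : (1 + ‖x - z‖) ^ 2 ≤ (1 + ‖x‖) ^ 2 * (1 + ‖z‖) ^ 2 := by
      rw [← mul_pow]
      exact pow_le_pow_left₀ (by positivity) (peetre x z) 2
    calc F (x - z) * g z ≤ (k0 (x - z) + c * (1 + ‖x - z‖) ^ 2) * g z :=
          mul_le_mul_of_nonneg_right (hFb _) (hg0 z)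
      _ = k0 (x - z) * g z + c * (1 + ‖x - z‖) ^ 2 * g z := by ring
      _ ≤ k0 (x - z) * C + c * ((1 + ‖x‖) ^ 2 * (1 + ‖z‖) ^ 2) *
          (C * (1 + ‖z‖) ^ (-(2 * (d : ℝ) + 1))) := by
          apply add_le_add
          · exact mul_le_mul_of_nonneg_left h1 (hk00 _)
          · exact mul_le_mul (mul_le_mul_of_nonneg_left h2 hc) (hgb z) (hg0 z) (by positivity)
      _ = _ := by ring
  have hi : Integrable (fun z => F (x - z) * g z) := by
    refine hbi.mono' ?_ (Eventually.of_forall fun z => ?_)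
    · exact ((hFm.comp (measurable_const.sub measurable_id)).mul
        hgc.measurable).aestronglyMeasurable
    · rw [Real.norm_of_nonneg (mul_nonneg (hF0 _) (hg0 _))]
      exact hb z
  refine ⟨hi, (integral_mono hi hbi hb).trans ?_⟩
  rw [integral_add (hkx.const_mul C) (hW.const_mul _), integral_const_mul, integral_const_mul,
    integral_sub_left_eq_self (fun z => k0 z) volume x]
  have h1 : (1 : ℝ) ≤ (1 + ‖x‖) ^ 2 := one_le_pow₀ (by linarith [norm_nonneg x])
  have h2 : 0 ≤ C * ∫ z, k0 z := mul_nonneg hC (integral_nonneg hk00)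
  nlinarith [mul_le_mul_of_nonneg_left h1 h2]

lemma conv_continuous {d : ℕ} (hd : 3 ≤ d) {F k0 g : EuclideanSpace ℝ (Fin d) → ℝ} {c C : ℝ}
    (hFm : Measurable F) (hF0 : ∀ v, 0 ≤ F v) (hk0 : Integrable k0)
    (hk00 : ∀ v, 0 ≤ k0 v) (hc : 0 ≤ c) (hFb : ∀ v, F v ≤ k0 v + c * (1 + ‖v‖) ^ 2)
    (hgc : Continuous g) (hg0 : ∀ v, 0 ≤ g v) (hC : 0 ≤ C)
    (hgb : ∀ v, g v ≤ C * (1 + ‖v‖) ^ (-(2 * (d : ℝ) + 1))) :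
    Continuous (fun x => ∫ z, F (x - z) * g z) := by
  have hW := weight_integrable hd
  have heq : (fun x => ∫ z, F (x - z) * g z) = fun x => ∫ z, F z * g (x - z) := by
    funext x
    rw [← integral_sub_left_eq_self (fun z => F z * g (x - z)) volume x]
    simp
  rw [heq, continuous_iff_continuousAt]
  intro x0
  have hkw : Integrable (fun z : EuclideanSpace ℝ (Fin d) =>
      k0 z * (1 + ‖z‖) ^ (-(2 * (d : ℝ) + 1))) := by
    refine hk0.mono' (hk0.aestronglyMeasurable.mul ?_) (Eventually.of_forall fun z => ?_)
    · exact Measurable.aestronglyMeasurable (by fun_prop)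
    · have hw0 : 0 ≤ (1 + ‖z‖) ^ (-(2 * (d : ℝ) + 1)) := by positivity
      rw [Real.norm_of_nonneg (mul_nonneg (hk00 z) hw0)]
      have := mul_le_mul_of_nonneg_left (weight_le_one z) (hk00 z)
      linarith
  refine continuousAt_of_dominated (bound := fun z =>
    C * (2 + ‖x0‖) ^ (2 * (d : ℝ) + 1) * (k0 z * (1 + ‖z‖) ^ (-(2 * (d : ℝ) + 1)) +
      c * ((1 + ‖z‖) ^ 2 * (1 + ‖z‖) ^ (-(2 * (d : ℝ) + 1))))) ?_ ?_ ?_ ?_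
  · exact Eventually.of_forall fun x => (hFm.mul
      (hgc.measurable.comp (measurable_const.sub measurable_id))).aestronglyMeasurable
  · filter_upwards [Metric.ball_mem_nhds x0 one_pos] with x hx
    refine Eventually.of_forall fun z => ?_
    rw [Real.norm_of_nonneg (mul_nonneg (hF0 _) (hg0 _))]
    have hx1 : 1 + ‖x‖ ≤ 2 + ‖x0‖ := by
      have h1 : ‖x - x0‖ < 1 := by simpa [dist_eq_norm] using hx
      have := norm_sub_norm_le x x0
      linarith
    have hs : 0 ≤ 2 * (d : ℝ) + 1 := by positivity
    have h3 : (1 + ‖x - z‖) ^ (-(2 * (d : ℝ) + 1)) ≤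
        (2 + ‖x0‖) ^ (2 * (d : ℝ) + 1) * (1 + ‖z‖) ^ (-(2 * (d : ℝ) + 1)) := by
      have h4 : 1 + ‖z‖ ≤ (2 + ‖x0‖) * (1 + ‖x - z‖) := by
        have := peetre x (x - z)
        rw [sub_sub_cancel] at this
        refine this.trans (mul_le_mul_of_nonneg_right hx1 (by positivity))
      have h5 := Real.rpow_le_rpow (by positivity) h4 hs
      rw [Real.mul_rpow (by positivity) (by positivity)] at h5
      rw [Real.rpow_neg (by positivity), Real.rpow_neg (by positivity), ← div_eq_mul_inv,
        le_div_iff₀ (by positivity), inv_mul_le_iff₀ (by positivity)]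
      linarith [h5]
    have h6 : g (x - z) ≤ C * ((2 + ‖x0‖) ^ (2 * (d : ℝ) + 1) *
        (1 + ‖z‖) ^ (-(2 * (d : ℝ) + 1))) :=
      (hgb _).trans (mul_le_mul_of_nonneg_left h3 hC)
    calc F z * g (x - z) ≤ (k0 z + c * (1 + ‖z‖) ^ 2) * (C * ((2 + ‖x0‖) ^ (2 * (d : ℝ) + 1) *
        (1 + ‖z‖) ^ (-(2 * (d : ℝ) + 1)))) :=
          mul_le_mul (hFb z) h6 (hg0 _) (add_nonneg (hk00 z) (by positivity))
      _ = _ := by ring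
  · exact (hkw.add (hW.const_mul c)).const_mul _
  · exact Eventually.of_forall fun z =>
      (continuous_const.mul (hgc.comp (continuous_id.sub continuous_const))).continuousAt

lemma conv_coercive {d : ℕ} {F g : EuclideanSpace ℝ (Fin d) → ℝ}
    (hF0 : ∀ v, 0 ≤ F v) (hgc : Continuous g) (hg0 : ∀ v, 0 ≤ g v)
    (hi : ∀ x, Integrable (fun z => F (x - z) * g z))
    (hz : ∃ z0, 0 < g z0) (hco : ∀ T : ℝ, ∃ R : ℝ, ∀ x, R ≤ ‖x‖ → T ≤ F x) :
    ∀ T : ℝ, ∃ R : ℝ, ∀ x, R ≤ ‖x‖ → T ≤ ∫ z, F (x - z) * g z := by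
  intro T
  obtain ⟨z0, hz0⟩ := hz
  obtain ⟨δ, hδ, hball⟩ := Metric.eventually_nhds_iff_ball.1
    (hgc.continuousAt.eventually (lt_mem_nhds (half_lt_self hz0)))
  set m := volume.real (Metric.ball z0 δ) with hm
  have hmpos : 0 < m := ENNReal.toReal_pos (Metric.measure_ball_pos _ _ hδ).ne'
    measure_ball_lt_top.ne
  obtain ⟨R, hR⟩ := hco (|T| / (g z0 / 2 * m))
  refine ⟨R + ‖z0‖ + δ, fun x hx => ?_⟩
  have hBm : MeasurableSet (Metric.ball z0 δ) := Metric.isOpen_ball.measurableSet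
  calc T ≤ |T| := le_abs_self T
    _ = m * (|T| / (g z0 / 2 * m) * (g z0 / 2)) := by field_simp
    _ = ∫ z in Metric.ball z0 δ, |T| / (g z0 / 2 * m) * (g z0 / 2) := by
      rw [setIntegral_const, smul_eq_mul]
    _ ≤ ∫ z in Metric.ball z0 δ, F (x - z) * g z := by
      refine setIntegral_mono_on ?_ (hi x).integrableOn hBm fun z hz => ?_
      · exact integrableOn_const measure_ball_lt_top.ne
      · refine mul_le_mul (hR _ ?_) (hball z hz).le (by positivity) (hF0 _)
        have h1 : ‖z - z0‖ < δ := by simpa [dist_eq_norm] using hz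
        have h2 := norm_sub_norm_le z z0
        have h3 := norm_sub_norm_le x z
        linarith
    _ ≤ _ := setIntegral_le_integral (hi x)
      (Eventually.of_forall fun z => mul_nonneg (hF0 _) (hg0 _))

lemma Kfun_nonneg {d : ℕ} {p q : ℝ} (hp2 : p < 0) (hq1 : 0 < q)
    (x : EuclideanSpace ℝ (Fin d)) : 0 ≤ Kfun d p q x := by
  unfold Kfun
  have h1 : 0 ≤ ‖x‖ ^ q / q := by positivity
  have h2 : ‖x‖ ^ p / p ≤ 0 := div_nonpos_of_nonneg_of_nonpos (by positivity) hp2.le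
  linarith

lemma Kfun_coercive {d : ℕ} {p q : ℝ} (hp2 : p < 0) (hq1 : 0 < q) :
    ∀ T : ℝ, ∃ R : ℝ, ∀ x : EuclideanSpace ℝ (Fin d), R ≤ ‖x‖ → T ≤ Kfun d p q x := by
  intro T
  obtain ⟨R, hR⟩ := eventually_atTop.1 ((tendsto_rpow_atTop hq1).eventually_ge_atTop (T * q))
  refine ⟨R, fun x hx => ?_⟩
  unfold Kfun
  have h1 : T ≤ ‖x‖ ^ q / q := (le_div_iff₀ hq1).2 (hR _ hx)
  have h2 : ‖x‖ ^ p / p ≤ 0 := div_nonpos_of_nonneg_of_nonpos (by positivity) hp2.le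
  linarith

/-- Integrable singular part of the kernel. -/
def singPart (d : ℕ) (p : ℝ) (x : EuclideanSpace ℝ (Fin d)) : ℝ :=
  (Set.Iio (1 : ℝ)).indicator (fun r => r ^ p / (-p)) ‖x‖

lemma singPart_nonneg {d : ℕ} {p : ℝ} (hp2 : p < 0) (x : EuclideanSpace ℝ (Fin d)) :
    0 ≤ singPart d p x := by
  unfold singPart Set.indicator
  split_ifs
  · have : 0 < -p := by linarith
    positivity
  · exact le_rfl

lemma singPart_integrable {d : ℕ} (hd : 3 ≤ d) {p : ℝ} (hp1 : 2 - (d : ℝ) ≤ p) :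
    Integrable (singPart d p) := by
  have : Nontrivial (EuclideanSpace ℝ (Fin d)) := by
    apply Module.nontrivial_of_finrank_pos (R := ℝ)
    rw [finrank_euclideanSpace_fin]; omega
  unfold singPart
  rw [integrable_fun_norm_addHaar (μ := volume)
    (f := (Set.Iio (1 : ℝ)).indicator (fun r => r ^ p / (-p)))]
  rw [finrank_euclideanSpace_fin]
  have h1 : IntegrableOn (fun y : ℝ => y ^ ((d : ℝ) - 1 + p) / (-p)) (Set.Ioo 0 1) := by
    have := (intervalIntegral.integrableOn_Ioo_rpow_iff (s := (d : ℝ) - 1 + p) one_pos).2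
      (by linarith)
    exact this.div_const _
  have h2 : IntegrableOn (fun y : ℝ => y ^ (d - 1) • (Set.Iio (1 : ℝ)).indicator
      (fun r => r ^ p / (-p)) y) (Set.Ioo 0 1) := by
    refine h1.congr_fun (fun y hy => ?_) measurableSet_Ioo
    simp only [Set.indicator, Set.mem_Iio, hy.2, if_true, smul_eq_mul]
    rw [Real.rpow_add hy.1, ← Real.rpow_natCast, Nat.cast_sub (by omega)]
    push_cast
    ring
  have h3 : IntegrableOn (fun y : ℝ => y ^ (d - 1) • (Set.Iio (1 : ℝ)).indicator
      (fun r => r ^ p / (-p)) y) (Set.Ici 1) := by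
    refine integrableOn_zero.congr_fun (fun y hy => ?_) measurableSet_Ici
    simp [Set.indicator, not_lt.2 (show (1 : ℝ) ≤ y from hy)]
  rw [← Set.Ioo_union_Ici_eq_Ioi one_pos]
  exact h2.union h3

lemma Kfun_bound {d : ℕ} {p q : ℝ} (hp2 : p < 0) (hq1 : 0 < q) (hq2 : q ≤ 2)
    (x : EuclideanSpace ℝ (Fin d)) :
    Kfun d p q x ≤ singPart d p x + (1 / q + 1 / (-p)) * (1 + ‖x‖) ^ 2 := by
  have hp' : 0 < -p := by linarith
  have h1 : ‖x‖ ^ q ≤ (1 + ‖x‖) ^ 2 := by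
    calc ‖x‖ ^ q ≤ (1 + ‖x‖) ^ q :=
          Real.rpow_le_rpow (norm_nonneg x) (by linarith) hq1.le
      _ ≤ (1 + ‖x‖) ^ (2 : ℝ) :=
          Real.rpow_le_rpow_of_exponent_le (by linarith [norm_nonneg x]) hq2
      _ = _ := by norm_cast
  have h2 : ‖x‖ ^ p / (-p) ≤ singPart d p x + 1 / (-p) * (1 + ‖x‖) ^ 2 := by
    unfold singPart Set.indicator
    split_ifs with hx
    · have : 0 ≤ 1 / (-p) * (1 + ‖x‖) ^ 2 := by positivity
      linarith
    · have hx' : 1 ≤ ‖x‖ := not_lt.1 hx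
      have h3 : ‖x‖ ^ p ≤ 1 := Real.rpow_le_one_of_one_le_of_nonpos hx' hp2.le
      have h4 : (1 : ℝ) ≤ (1 + ‖x‖) ^ 2 := one_le_pow₀ (by linarith)
      rw [zero_add, one_div, inv_mul_eq_div]
      exact div_le_div_of_nonneg_right (h3.trans h4) hp'.le
  have h5 : ‖x‖ ^ q / q ≤ 1 / q * (1 + ‖x‖) ^ 2 := by
    rw [one_div, inv_mul_eq_div]
    exact div_le_div_of_nonneg_right h1 hq1.le
  unfold Kfun
  have h6 : ‖x‖ ^ p / p = -(‖x‖ ^ p / (-p)) := by rw [div_neg, neg_neg]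
  rw [h6, add_mul]
  linarith

lemma scaled_bound {d : ℕ} {φ : EuclideanSpace ℝ (Fin d) → ℝ} (hφ : IsMollifier d φ) {ε : ℝ}
    (hε : 0 < ε) : ∃ C : ℝ, 0 ≤ C ∧ ∀ v : EuclideanSpace ℝ (Fin d),
      scaled d φ ε v ≤ C * (1 + ‖v‖) ^ (-(2 * (d : ℝ) + 1)) := by
  obtain ⟨hsm, -, h0, -, C, hC, l, hl, hb⟩ := hφ
  have hls : 2 * (d : ℝ) + 1 ≤ l := (le_max_left _ _).trans hl
  have hs : 0 ≤ 2 * (d : ℝ) + 1 := by positivity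
  have hcont : Continuous (scaled d φ ε) := by
    unfold scaled
    exact continuous_const.mul (hsm.continuous.comp (continuous_const_smul ε⁻¹))
  obtain ⟨M, hM⟩ := (isCompact_closedBall (0 : EuclideanSpace ℝ (Fin d)) 1).bddAbove_image
    hcont.continuousOn
  have hM0 : 0 ≤ max M 0 := le_max_right _ _
  have hCl : 0 ≤ (ε ^ d)⁻¹ * (C * ε ^ l) := by positivity
  refine ⟨(max M 0 + (ε ^ d)⁻¹ * (C * ε ^ l)) * 2 ^ (2 * (d : ℝ) + 1), by positivity,
    fun v => ?_⟩
  have hq0 : 0 < 1 + ‖v‖ := by positivity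
  rw [mul_assoc, Real.rpow_neg hq0.le, ← div_eq_mul_inv,
    ← Real.div_rpow (by norm_num) hq0.le]
  by_cases hv : ‖v‖ ≤ 1
  · have h1 : scaled d φ ε v ≤ max M 0 :=
      (hM ⟨v, by simpa using hv, rfl⟩).trans (le_max_left _ _)
    have h2 : 1 ≤ (2 / (1 + ‖v‖)) ^ (2 * (d : ℝ) + 1) := by
      apply Real.one_le_rpow _ hs
      rw [le_div_iff₀ hq0]; linarith
    nlinarith
  · have hv1 : 1 < ‖v‖ := not_le.1 hv
    have hv0 : v ≠ 0 := by
      rintro rfl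
      simp at hv1
      linarith
    have h1 := hb (ε⁻¹ • v) (smul_ne_zero (inv_ne_zero hε.ne') hv0)
    have h2 : ‖ε⁻¹ • v‖ ^ (-l) = ε ^ l * ‖v‖ ^ (-l) := by
      rw [norm_smul, Real.norm_of_nonneg (by positivity),
        Real.mul_rpow (by positivity) (norm_nonneg v), Real.inv_rpow hε.le,
        Real.rpow_neg hε.le, inv_inv]
    have h3 : ‖v‖ ^ (-l) ≤ (2 / (1 + ‖v‖)) ^ (2 * (d : ℝ) + 1) := by
      calc ‖v‖ ^ (-l) ≤ ‖v‖ ^ (-(2 * (d : ℝ) + 1)) :=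
            Real.rpow_le_rpow_of_exponent_le hv1.le (by linarith)
        _ = (‖v‖⁻¹) ^ (2 * (d : ℝ) + 1) := by
            rw [Real.rpow_neg (norm_nonneg v), Real.inv_rpow (norm_nonneg v)]
        _ ≤ _ := by
            apply Real.rpow_le_rpow (by positivity) _ hs
            rw [inv_le_iff_one_le_mul₀ (by linarith), div_mul_eq_mul_div, le_div_iff₀ hq0]
            linarith
    have h4 : scaled d φ ε v ≤ (ε ^ d)⁻¹ * (C * ε ^ l) * ‖v‖ ^ (-l) := by
      unfold scaled
      rw [h2] at h1
      calc _ ≤ (ε ^ d)⁻¹ * (C * (ε ^ l * ‖v‖ ^ (-l))) :=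
            mul_le_mul_of_nonneg_left h1 (by positivity)
        _ = _ := by ring
    calc _ ≤ (ε ^ d)⁻¹ * (C * ε ^ l) * ‖v‖ ^ (-l) := h4
      _ ≤ (ε ^ d)⁻¹ * (C * ε ^ l) * (2 / (1 + ‖v‖)) ^ (2 * (d : ℝ) + 1) :=
          mul_le_mul_of_nonneg_left h3 hCl
      _ ≤ _ := mul_le_mul_of_nonneg_right (by linarith) (by positivity)

lemma Kreg_props {d : ℕ} (hd : 3 ≤ d) {p q : ℝ} (hp1 : 2 - (d : ℝ) ≤ p) (hp2 : p < 0)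
    (hq1 : 0 < q) (hq2 : q ≤ 2) {φ : EuclideanSpace ℝ (Fin d) → ℝ} (hφ : IsMollifier d φ)
    {ε : ℝ} (hε : 0 < ε) :
    Continuous (Kreg d p q φ ε) ∧
      ∀ T : ℝ, ∃ R : ℝ, ∀ x, R ≤ ‖x‖ → T ≤ Kreg d p q φ ε x := by
  obtain ⟨C, hC, hgb⟩ := scaled_bound hφ hε
  obtain ⟨hsm, -, h0, hint, -⟩ := hφ
  set g := scaled d φ ε with hg
  have hgc : Continuous g := by
    rw [hg]
    unfold scaled
    exact continuous_const.mul (hsm.continuous.comp (continuous_const_smul ε⁻¹))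
  have hg0 : ∀ v, 0 ≤ g v := fun v => mul_nonneg (by positivity) (h0 _)
  have hz : ∃ z0, 0 < g z0 := by
    by_contra! hcon
    have : ∀ x, φ x = 0 := by
      intro x
      refine le_antisymm ?_ (h0 x)
      have h1 := hcon (ε • x)
      rw [hg, scaled, inv_smul_smul₀ hε.ne'] at h1
      by_contra! h2
      have : 0 < (ε ^ d)⁻¹ * φ x := by positivity
      linarith
    simp [this] at hint
  have hp' : 0 < -p := by linarith
  have hKm : Measurable (Kfun d p q) := by
    unfold Kfun
    fun_prop
  have hK0 := Kfun_nonneg (d := d) hp2 hq1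
  have hc : 0 ≤ 1 / q + 1 / (-p) := by positivity
  have hKb := Kfun_bound (d := d) hp2 hq1 hq2
  have hs0 := singPart_nonneg (d := d) hp2
  have hsi := singPart_integrable hd hp1
  set G : EuclideanSpace ℝ (Fin d) → ℝ := fun u => ∫ z, Kfun d p q (u - z) * g z with hG
  have hGi := fun x => conv_integrable hd hKm hK0 hsi hs0 hc hKb hgc hg0 hC hgb x
  have hGc : Continuous G := conv_continuous hd hKm hK0 hsi hs0 hc hKb hgc hg0 hC hgb
  have hG0 : ∀ u, 0 ≤ G u := fun u => integral_nonneg fun z => mul_nonneg (hK0 _) (hg0 _)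
  have hGco : ∀ T : ℝ, ∃ R : ℝ, ∀ x, R ≤ ‖x‖ → T ≤ G x :=
    conv_coercive hK0 hgc hg0 (fun x => (hGi x).1) hz (Kfun_coercive hp2 hq1)
  set c' : ℝ := (C * (∫ z, singPart d p z) + (1 / q + 1 / (-p)) * C *
    ∫ z : EuclideanSpace ℝ (Fin d), (1 + ‖z‖) ^ 2 * (1 + ‖z‖) ^ (-(2 * (d : ℝ) + 1))) with hc'
  have hc'0 : 0 ≤ c' := by
    have h1 : 0 ≤ ∫ z, singPart d p z := integral_nonneg hs0
    have h2 : 0 ≤ ∫ z : EuclideanSpace ℝ (Fin d),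
      (1 + ‖z‖) ^ 2 * (1 + ‖z‖) ^ (-(2 * (d : ℝ) + 1)) := integral_nonneg fun z => by positivity
    positivity
  have hGb : ∀ v, G v ≤ (fun _ => (0 : ℝ)) v + c' * (1 + ‖v‖) ^ 2 := fun v => by
    simpa using (hGi v).2
  have hzi : Integrable (fun _ : EuclideanSpace ℝ (Fin d) => (0 : ℝ)) := integrable_zero _ _ _
  have hHi := fun x => (conv_integrable hd hGc.measurable hG0 hzi (fun _ => le_rfl) hc'0 hGb
    hgc hg0 hC hgb x).1
  have hHc := conv_continuous hd hGc.measurable hG0 hzi (fun _ => le_rfl) hc'0 hGb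
    hgc hg0 hC hgb
  have hHco := conv_coercive hG0 hgc hg0 hHi hz hGco
  have heq : Kreg d p q φ ε = fun x => ∫ y, G (x - y) * g y := by
    funext x
    unfold Kreg
    refine integral_congr_ae (Eventually.of_forall fun y => ?_)
    simp only [hG, mul_assoc]
    rw [integral_const_mul, mul_comm]
  rw [heq]
  exact ⟨hHc, hHco⟩

/-- For `ε` sufficiently small, the regularized energy `E_ε` admits a
minimizer over `P₂(ℝ^d)`. -/
theorem regularized_energy_has_minimizer
    (d : ℕ) (hd : 3 ≤ d) (p q : ℝ) (hp1 : 2 - (d : ℝ) ≤ p) (hp2 : p < 0)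
    (hq1 : 0 < q) (hq2 : q ≤ 2)
    (φ : EuclideanSpace ℝ (Fin d) → ℝ) (hφ : IsMollifier d φ) :
    ∃ ε₀ : ℝ, 0 < ε₀ ∧ ∀ ε : ℝ, 0 < ε → ε < ε₀ →
      ∃ με : Measure (EuclideanSpace ℝ (Fin d)), IsP2 d με ∧
        ∀ ν : Measure (EuclideanSpace ℝ (Fin d)), IsP2 d ν →
          energyReg d p q φ ε με ≤ energyReg d p q φ ε ν := by
  refine ⟨1, one_pos, fun ε hε _ => ?_⟩
  obtain ⟨hc, hco⟩ := Kreg_props hd hp1 hp2 hq1 hq2 hφ hε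
  exact exists_min_of_coercive hc hco
end
end

section
/- (Recovery sequence.) For μ ∈ P_2(ℝ^d), set δ(ε) := ε^{1/(2d)} and define the recovery measures ν_ε := μ * ψ_{δ(ε)}, where ψ is the heat kernel (ψ_δ(x) = δ^{−d}ψ(x/δ) with ψ(x) = (4π)^{−d/2}e^{−|x|²/4}). Then as ε → 0: (a) ν_ε → μ weakly-* and ∫|x|² dν_ε → ∫|x|² dμ; and (b) E_ε(ν_ε) → E(μ). -/
open MeasureTheory Filter
open scoped ENNReal Topology NNReal

noncomputable section

/-- The measure with density `φ`. -/
noncomputable def mm (d : ℕ) (φ : EuclideanSpace ℝ (Fin d) → ℝ) :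
    Measure (EuclideanSpace ℝ (Fin d)) :=
  volume.withDensity fun x => ENNReal.ofReal (φ x)

lemma lintegral_smul_var (d : ℕ) (h : EuclideanSpace ℝ (Fin d) → ℝ≥0∞) (hh : Measurable h)
    {r : ℝ} (hr : 0 < r) :
    ∫⁻ v, h (r • v) = ENNReal.ofReal ((r ^ d)⁻¹) * ∫⁻ v, h v := by
  have h1 := Measure.map_addHaar_smul (volume : Measure (EuclideanSpace ℝ (Fin d))) hr.ne'
  rw [← lintegral_map (f := h) (g := fun v => r • v) hh (by fun_prop), h1,
    lintegral_smul_measure, finrank_euclideanSpace_fin, abs_of_nonneg (by positivity)]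
  rfl

lemma lintegral_mm (d : ℕ) (φ : EuclideanSpace ℝ (Fin d) → ℝ) (hφ : Measurable φ)
    (f : EuclideanSpace ℝ (Fin d) → ℝ≥0∞) (hf : Measurable f) :
    ∫⁻ z, f z ∂(mm d φ) = ∫⁻ z, ENNReal.ofReal (φ z) * f z := by
  rw [mm, lintegral_withDensity_eq_lintegral_mul _ (by fun_prop) hf]
  rfl

lemma lintegral_scaled (d : ℕ) (φ : EuclideanSpace ℝ (Fin d) → ℝ) (hφ : Measurable φ)
    {ε : ℝ} (hε : 0 < ε) (f : EuclideanSpace ℝ (Fin d) → ℝ≥0∞) (hf : Measurable f) :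
    ∫⁻ y, ENNReal.ofReal (scaled d φ ε y) * f y = ∫⁻ z, f (ε • z) ∂(mm d φ) := by
  rw [lintegral_mm d φ hφ _ (by fun_prop)]
  have := lintegral_smul_var d (fun y => ENNReal.ofReal (φ (ε⁻¹ • y)) * f y)
    (by fun_prop) hε
  simp only [smul_smul, inv_mul_cancel₀ hε.ne', one_smul] at this
  rw [this, ← lintegral_const_mul _ (by fun_prop)]
  refine lintegral_congr fun y => ?_
  rw [scaled, ENNReal.ofReal_mul (by positivity), mul_assoc]

lemma IsMollifier.meas {d : ℕ} {φ : EuclideanSpace ℝ (Fin d) → ℝ} (h : IsMollifier d φ) :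
    Measurable φ := h.1.continuous.measurable

lemma IsMollifier.prob {d : ℕ} {φ : EuclideanSpace ℝ (Fin d) → ℝ} (h : IsMollifier d φ) :
    IsProbabilityMeasure (mm d φ) := by
  obtain ⟨_, _, h0, h1, _⟩ := h
  constructor
  rw [mm, withDensity_apply _ MeasurableSet.univ, Measure.restrict_univ,
    ← ofReal_integral_eq_lintegral_ofReal _ (Eventually.of_forall h0), h1, ENNReal.ofReal_one]
  by_contra hc
  rw [integral_undef hc] at h1
  norm_num at h1

lemma IsMollifier.bound {d : ℕ} {φ : EuclideanSpace ℝ (Fin d) → ℝ} (h : IsMollifier d φ) :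
    ∃ M : ℝ, 0 < M ∧ ∀ x, φ x ≤ M * (1 + ‖x‖) ^ (-(2 * (d : ℝ) + 1)) := by
  obtain ⟨hc, _, h0, h1, C, hC, l, hl, hb⟩ := h
  obtain ⟨B, hB⟩ := (isCompact_closedBall (0 : EuclideanSpace ℝ (Fin d)) 1).exists_bound_of_continuousOn
    hc.continuous.continuousOn
  set s : ℝ := 2 * (d : ℝ) + 1 with hs
  have hs0 : 0 < s := by positivity
  have hls : s ≤ l := le_trans (le_max_left _ _) hl
  refine ⟨(|B| + C) * 2 ^ s, by positivity, fun x => ?_⟩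
  have hpos : 0 < 1 + ‖x‖ := by positivity
  by_cases hx : ‖x‖ ≤ 1
  · have h2 : φ x ≤ |B| := (le_abs_self _).trans ((hB x (by simpa using hx)).trans (le_abs_self _))
    have h3 : (1:ℝ) ≤ 2 ^ s * (1 + ‖x‖) ^ (-s) := by
      rw [Real.rpow_neg hpos.le, ← div_eq_mul_inv, ← Real.div_rpow (by norm_num) hpos.le]
      apply Real.one_le_rpow _ hs0.le
      rw [le_div_iff₀ hpos]; linarith
    have : 0 ≤ |B| := abs_nonneg _
    calc φ x ≤ (|B| + C) * 1 := by linarith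
      _ ≤ (|B| + C) * (2 ^ s * (1 + ‖x‖) ^ (-s)) := by gcongr
      _ = _ := by ring
  · push Not at hx
    have hx0 : x ≠ 0 := by rintro rfl; norm_num at hx
    have h3 : ‖x‖ ^ (-l) ≤ 2 ^ s * (1 + ‖x‖) ^ (-s) := by
      calc ‖x‖ ^ (-l) ≤ ‖x‖ ^ (-s) := Real.rpow_le_rpow_of_exponent_le hx.le (by linarith)
        _ ≤ ((1 + ‖x‖) / 2) ^ (-s) :=
          Real.rpow_le_rpow_of_nonpos (by positivity) (by linarith) (by linarith)
        _ = _ := by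
          rw [Real.rpow_neg (by positivity), Real.rpow_neg hpos.le, Real.div_rpow hpos.le (by norm_num)]
          field_simp
    calc φ x ≤ C * ‖x‖ ^ (-l) := hb x hx0
      _ ≤ C * (2 ^ s * (1 + ‖x‖) ^ (-s)) := by gcongr
      _ ≤ (|B| + C) * (2 ^ s * (1 + ‖x‖) ^ (-s)) := by gcongr; linarith [abs_nonneg B]
      _ = _ := by ring

lemma IsMollifier.bound_pow {d : ℕ} {φ : EuclideanSpace ℝ (Fin d) → ℝ} (h : IsMollifier d φ) :
    ∃ M : ℝ, 0 < M ∧ ∀ x, φ x * ‖x‖ ^ d ≤ M := by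
  obtain ⟨M, hM, hb⟩ := h.bound
  refine ⟨M, hM, fun x => ?_⟩
  have hpos : 0 < 1 + ‖x‖ := by positivity
  calc φ x * ‖x‖ ^ d ≤ (M * (1 + ‖x‖) ^ (-(2 * (d : ℝ) + 1))) * (1 + ‖x‖) ^ d := by
        gcongr
        · exact hb x
        · linarith
    _ = M * (1 + ‖x‖) ^ (-(d : ℝ) - 1) := by
        rw [← Real.rpow_natCast, mul_assoc, ← Real.rpow_add hpos]; ring_nf
    _ ≤ M * 1 := by
        gcongr
        apply Real.rpow_le_one_of_one_le_of_nonpos (by linarith [norm_nonneg x])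
        have : (0:ℝ) ≤ d := by positivity
        linarith
    _ = M := mul_one M

lemma IsMollifier.moment {d : ℕ} (hd : 3 ≤ d) {φ : EuclideanSpace ℝ (Fin d) → ℝ}
    (h : IsMollifier d φ) : ∫⁻ z, (‖z‖₊ : ℝ≥0∞) ^ 2 ∂(mm d φ) < ⊤ := by
  obtain ⟨M, hM, hb⟩ := h.bound
  rw [lintegral_mm d φ h.meas _ (by fun_prop)]
  have hd' : (3:ℝ) ≤ d := by exact_mod_cast hd
  have hfin := finite_integral_one_add_norm (E := EuclideanSpace ℝ (Fin d)) (μ := volume)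
    (r := 2 * (d:ℝ) - 1) (by simp; linarith)
  have : ∫⁻ x : EuclideanSpace ℝ (Fin d),
      ENNReal.ofReal M * ENNReal.ofReal ((1 + ‖x‖) ^ (-(2 * (d:ℝ) - 1))) < ⊤ := by
    rw [lintegral_const_mul _ (by fun_prop)]
    exact ENNReal.mul_lt_top ENNReal.ofReal_lt_top hfin
  refine lt_of_le_of_lt (lintegral_mono fun x => ?_) this
  have hpos : 0 < 1 + ‖x‖ := by positivity
  have e : (‖x‖₊ : ℝ≥0∞) ^ 2 = ENNReal.ofReal (‖x‖ ^ 2) := by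
    rw [ENNReal.ofReal_pow (norm_nonneg x), ofReal_norm]; rfl
  dsimp only
  rw [e, ← ENNReal.ofReal_mul (h.2.2.1 x), ← ENNReal.ofReal_mul hM.le]
  apply ENNReal.ofReal_le_ofReal
  calc φ x * ‖x‖ ^ 2 ≤ (M * (1 + ‖x‖) ^ (-(2 * (d : ℝ) + 1))) * (1 + ‖x‖) ^ 2 := by
        gcongr
        · exact hb x
        · linarith
    _ = _ := by
        rw [← Real.rpow_natCast, mul_assoc, ← Real.rpow_add hpos]
        push_cast; ring_nf

lemma ball_finite (d : ℕ) (hd : 3 ≤ d) (p : ℝ) (hp : -(d:ℝ) < p) :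
    ∫⁻ w : EuclideanSpace ℝ (Fin d) in Metric.ball 0 1, (‖w‖₊ : ℝ≥0∞) ^ p < ⊤ := by
  have : Nonempty (Fin d) := ⟨⟨0, by omega⟩⟩
  have h1 : IntegrableOn (fun w : EuclideanSpace ℝ (Fin d) => ‖w‖ ^ p) (Metric.ball 0 1) := by
    have := (integrableOn_fun_norm_addHaar (E := EuclideanSpace ℝ (Fin d)) volume
      (f := fun r : ℝ => r ^ p) (r := 1)).2
    refine this ?_
    have h2 : IntegrableOn (fun y : ℝ => y ^ ((d:ℝ) - 1 + p)) (Set.Ioo 0 1) :=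
      (intervalIntegral.integrableOn_Ioo_rpow_iff (by norm_num)).2 (by linarith)
    refine h2.congr_fun (fun y hy => ?_) measurableSet_Ioo
    have hy0 : 0 < y := hy.1
    simp only [finrank_euclideanSpace_fin, smul_eq_mul]
    rw [Real.rpow_add hy0, ← Real.rpow_natCast, Nat.cast_sub (by omega), Nat.cast_one]
  have h3 := h1.2
  rw [hasFiniteIntegral_iff_enorm] at h3
  refine lt_of_le_of_lt (le_of_eq ?_) h3
  refine lintegral_congr_ae (ae_restrict_of_ae ?_)
  filter_upwards [Measure.ae_ne (volume : Measure (EuclideanSpace ℝ (Fin d))) 0] with w hw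
  have : 0 < ‖w‖ := norm_pos_iff.2 hw
  rw [Real.enorm_of_nonneg (by positivity), ← ENNReal.ofReal_rpow_of_pos this, ofReal_norm]; rfl

lemma nn_eq (d : ℕ) (x : EuclideanSpace ℝ (Fin d)) : (‖x‖₊ : ℝ≥0∞) = ENNReal.ofReal ‖x‖ := by
  rw [ofReal_norm]; rfl

lemma meas_pow (d : ℕ) (p : ℝ) :
    Measurable (fun x : EuclideanSpace ℝ (Fin d) => (‖x‖₊ : ℝ≥0∞) ^ p) := by
  fun_prop

lemma pot1 {d : ℕ} (hd : 3 ≤ d) {φ : EuclideanSpace ℝ (Fin d) → ℝ}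
    (h : IsMollifier d φ) (p : ℝ) (hp : -(d:ℝ) < p) (hp2 : p < 0) :
    ∃ C : ℝ≥0∞, C ≠ ⊤ ∧ 1 ≤ C ∧ ∀ x : EuclideanSpace ℝ (Fin d),
      ∫⁻ u, (‖x - u‖₊ : ℝ≥0∞) ^ p ∂(mm d φ) ≤ C * (‖x‖₊ : ℝ≥0∞) ^ p := by
  obtain ⟨M, hM, hb⟩ := h.bound_pow
  have := h.prob
  set c := ∫⁻ w : EuclideanSpace ℝ (Fin d) in Metric.ball 0 1, (‖w‖₊ : ℝ≥0∞) ^ p with hc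
  have hcf : c < ⊤ := ball_finite d hd p hp
  have h2p : (1:ℝ) ≤ 2 ^ (-p) := Real.one_le_rpow (by norm_num) (by linarith)
  refine ⟨ENNReal.ofReal (2 ^ (-p)) * (1 + ENNReal.ofReal M * c), ?_, ?_, fun x => ?_⟩
  · exact ENNReal.mul_ne_top ENNReal.ofReal_ne_top
      (ENNReal.add_ne_top.2 ⟨ENNReal.one_ne_top, ENNReal.mul_ne_top ENNReal.ofReal_ne_top hcf.ne⟩)
  · calc (1:ℝ≥0∞) = 1 * 1 := by simp
      _ ≤ _ := mul_le_mul' (by simpa using ENNReal.ofReal_le_ofReal h2p) (by simp)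
  by_cases hx : x = 0
  · subst hx
    simp only [nnnorm_zero, ENNReal.coe_zero, ENNReal.zero_rpow_of_neg hp2]
    rw [ENNReal.mul_top]
    · exact le_top
    · simp; positivity
  have hx0 : 0 < ‖x‖ := norm_pos_iff.2 hx
  set r := ‖x‖ / 2 with hr
  have hr0 : 0 < r := by positivity
  set k : EuclideanSpace ℝ (Fin d) → ℝ≥0∞ :=
    (Metric.ball 0 r).indicator (fun w => (‖w‖₊ : ℝ≥0∞) ^ p) with hk
  have hkm : Measurable k := (meas_pow d p).indicator Metric.isOpen_ball.measurableSet
  -- integral of `k`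
  have hkint : ENNReal.ofReal ((r ^ d)⁻¹) * ∫⁻ w, k w = ENNReal.ofReal (r ^ p) * c := by
    rw [← lintegral_smul_var d k hkm hr0, hc, ← lintegral_indicator Metric.isOpen_ball.measurableSet,
      ← lintegral_const_mul _ ((meas_pow d p).indicator Metric.isOpen_ball.measurableSet)]
    refine lintegral_congr fun v => ?_
    have e1 : r • v ∈ Metric.ball (0 : EuclideanSpace ℝ (Fin d)) r ↔ v ∈ Metric.ball (0 : EuclideanSpace ℝ (Fin d)) 1 := by
      simp only [mem_ball_zero_iff, norm_smul, Real.norm_of_nonneg hr0.le]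
      constructor
      · intro h; by_contra h'; push Not at h'; nlinarith
      · intro h; nlinarith
    by_cases hv : v ∈ Metric.ball (0 : EuclideanSpace ℝ (Fin d)) 1
    · rw [hk, Set.indicator_of_mem (e1.2 hv), Set.indicator_of_mem hv, nn_eq, nn_eq, norm_smul,
        Real.norm_of_nonneg hr0.le, ENNReal.ofReal_mul hr0.le,
        ENNReal.mul_rpow_of_ne_top ENNReal.ofReal_ne_top ENNReal.ofReal_ne_top,
        ENNReal.ofReal_rpow_of_pos hr0]
    · rw [hk, Set.indicator_of_notMem (fun h => hv (e1.1 h)), Set.indicator_of_notMem hv, mul_zero]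
  have hrp : ENNReal.ofReal (r ^ p) = ENNReal.ofReal (2 ^ (-p)) * (‖x‖₊ : ℝ≥0∞) ^ p := by
    rw [nn_eq, ENNReal.ofReal_rpow_of_pos hx0, ← ENNReal.ofReal_mul (by positivity), hr,
      Real.div_rpow hx0.le (by norm_num), Real.rpow_neg (by norm_num)]
    congr 1; ring
  rw [lintegral_mm d φ h.meas _ (by fun_prop)]
  calc ∫⁻ u, ENNReal.ofReal (φ u) * (‖x - u‖₊ : ℝ≥0∞) ^ p
      ≤ ∫⁻ u, (ENNReal.ofReal (φ u) * ENNReal.ofReal (r ^ p)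
          + ENNReal.ofReal M * (ENNReal.ofReal ((r ^ d)⁻¹) * k (x - u))) := by
        refine lintegral_mono fun u => ?_
        dsimp only
        by_cases hu : x - u ∈ Metric.ball (0 : EuclideanSpace ℝ (Fin d)) r
        · refine le_trans ?_ le_add_self
          rw [hk, Set.indicator_of_mem hu, ← mul_assoc]
          gcongr
          rw [← ENNReal.ofReal_mul hM.le]
          apply ENNReal.ofReal_le_ofReal
          rw [mem_ball_zero_iff] at hu
          have hur : r ≤ ‖u‖ := by
            have := norm_sub_norm_le x u
            rw [hr] at hu ⊢; linarith
          rw [← div_eq_mul_inv, le_div_iff₀ (by positivity)]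
          calc φ u * r ^ d ≤ φ u * ‖u‖ ^ d := by
                gcongr
                exact h.2.2.1 u
            _ ≤ M := hb u
        · refine le_trans ?_ le_self_add
          gcongr
          rw [mem_ball_zero_iff] at hu
          push Not at hu
          rw [nn_eq, ENNReal.ofReal_rpow_of_pos (hr0.trans_le hu)]
          exact ENNReal.ofReal_le_ofReal (Real.rpow_le_rpow_of_nonpos hr0 hu hp2.le)
    _ = ENNReal.ofReal (r ^ p) + ENNReal.ofReal M * (ENNReal.ofReal ((r ^ d)⁻¹) * ∫⁻ w, k w) := by
        have hm := h.meas
        rw [lintegral_add_left (by fun_prop), lintegral_mul_const _ (by fun_prop),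
          lintegral_const_mul _ (by fun_prop), lintegral_const_mul _ (by fun_prop),
          lintegral_sub_left_eq_self]
        congr 1
        have h1 := lintegral_mm d φ h.meas (fun _ => 1) measurable_const
        simp only [lintegral_const, measure_univ, mul_one] at h1
        rw [← h1, one_mul]
    _ = _ := by rw [hkint, hrp]; ring

lemma pot {d : ℕ} (hd : 3 ≤ d) {φ : EuclideanSpace ℝ (Fin d) → ℝ}
    (h : IsMollifier d φ) (p : ℝ) (hp : -(d:ℝ) < p) (hp2 : p < 0) :
    ∃ C : ℝ≥0∞, C ≠ ⊤ ∧ ∀ (t : ℝ) (x : EuclideanSpace ℝ (Fin d)),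
      ∫⁻ u, (‖x + t • u‖₊ : ℝ≥0∞) ^ p ∂(mm d φ) ≤ C * (‖x‖₊ : ℝ≥0∞) ^ p := by
  obtain ⟨C, hC, hC1, hb⟩ := pot1 hd h p hp hp2
  have := h.prob
  refine ⟨C, hC, fun t x => ?_⟩
  by_cases ht : t = 0
  · subst ht
    simp only [zero_smul, add_zero, lintegral_const, measure_univ, mul_one]
    calc _ = 1 * (‖x‖₊ : ℝ≥0∞) ^ p := by rw [one_mul]
      _ ≤ _ := by gcongr
  have ht0 : 0 < |t| := abs_pos.2 ht
  have key : ∀ y : EuclideanSpace ℝ (Fin d),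
      (‖(-t) • y‖₊ : ℝ≥0∞) ^ p = ENNReal.ofReal (|t| ^ p) * (‖y‖₊ : ℝ≥0∞) ^ p := by
    intro y
    rw [nn_eq, nn_eq, norm_smul, norm_neg, Real.norm_eq_abs, ENNReal.ofReal_mul ht0.le,
        ENNReal.mul_rpow_of_ne_top ENNReal.ofReal_ne_top ENNReal.ofReal_ne_top,
        ENNReal.ofReal_rpow_of_pos ht0]
  have hx : (-t) • ((-t)⁻¹ • x) = x := smul_inv_smul₀ (neg_ne_zero.2 ht) x
  calc ∫⁻ u, (‖x + t • u‖₊ : ℝ≥0∞) ^ p ∂(mm d φ)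
      = ∫⁻ u, ENNReal.ofReal (|t| ^ p) * (‖(-t)⁻¹ • x - u‖₊ : ℝ≥0∞) ^ p ∂(mm d φ) := by
        refine lintegral_congr fun u => ?_
        rw [← key, smul_sub, hx, neg_smul, sub_neg_eq_add]
    _ = ENNReal.ofReal (|t| ^ p) * ∫⁻ u, (‖(-t)⁻¹ • x - u‖₊ : ℝ≥0∞) ^ p ∂(mm d φ) :=
        lintegral_const_mul _ (by fun_prop)
    _ ≤ ENNReal.ofReal (|t| ^ p) * (C * (‖(-t)⁻¹ • x‖₊ : ℝ≥0∞) ^ p) := by gcongr; exact hb _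
    _ = C * (‖(-t) • ((-t)⁻¹ • x)‖₊ : ℝ≥0∞) ^ p := by rw [key]; ring
    _ = _ := by rw [hx]

lemma heat_isMollifier {d : ℕ} (hd : 3 ≤ d) : IsMollifier d (heat d 1) := by
  have hpi := Real.pi_pos
  have hc : (0:ℝ) < (4 * Real.pi * 1) ^ (-(d : ℝ) / 2) := by positivity
  refine ⟨?_, ?_, ?_, ?_, ?_⟩
  · unfold heat
    have : ContDiff ℝ (⊤ : ℕ∞) (fun x : EuclideanSpace ℝ (Fin d) => ‖x‖ ^ 2) := contDiff_norm_sq ℝ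
    fun_prop
  · intro x y hxy; simp only [heat, hxy]
  · intro x; unfold heat; positivity
  · have h1 := GaussianFourier.integral_rexp_neg_mul_sq_norm (V := EuclideanSpace ℝ (Fin d))
      (b := 1/4) (by norm_num)
    have h2 : ∀ x : EuclideanSpace ℝ (Fin d), heat d 1 x =
        (4 * Real.pi * 1) ^ (-(d : ℝ) / 2) * Real.exp (-(1/4) * ‖x‖ ^ 2) := by
      intro x; unfold heat; congr 2; ring
    simp_rw [h2]
    rw [integral_const_mul, h1, finrank_euclideanSpace_fin,
      show Real.pi / (1/4) = 4 * Real.pi * 1 by ring, ← Real.rpow_add (by positivity)]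
    rw [show -(d:ℝ)/2 + d/2 = 0 by ring, Real.rpow_zero]
  · refine ⟨(4 * Real.pi * 1) ^ (-(d : ℝ) / 2) * (((d+1).factorial : ℝ) * 4 ^ (d+1)), by positivity,
      2 * ((d:ℝ) + 1), ?_, fun x hx => ?_⟩
    · have : (3:ℝ) ≤ d := by exact_mod_cast hd
      apply max_le <;> linarith
    have hx0 : 0 < ‖x‖ := norm_pos_iff.2 hx
    unfold heat
    rw [mul_assoc ((4 * Real.pi * 1) ^ (-(d : ℝ) / 2))]
    refine mul_le_mul_of_nonneg_left ?_ hc.le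
    have h1 := Real.pow_div_factorial_le_exp (‖x‖ ^ 2 / 4) (by positivity) (d+1)
    have e : ‖x‖ ^ (-(2 * ((d:ℝ) + 1))) = (‖x‖ ^ (2 * (d+1)))⁻¹ := by
      rw [Real.rpow_neg hx0.le, ← Real.rpow_natCast]; push_cast; rfl
    rw [e, neg_div, Real.exp_neg, mul_one]
    rw [inv_le_comm₀ (Real.exp_pos _) (by positivity)]
    refine le_trans (le_of_eq ?_) h1
    rw [pow_mul, div_pow]
    field_simp

lemma heat_eq_scaled (d : ℕ) {δ : ℝ} (hδ : 0 < δ) (x : EuclideanSpace ℝ (Fin d)) :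
    heat d δ x = scaled d (heat d 1) (√δ) x := by
  unfold scaled heat
  have hpi := Real.pi_pos
  have hs : 0 < √δ := Real.sqrt_pos.2 hδ
  have e1 : (4 * Real.pi * δ) ^ (-(d : ℝ) / 2)
      = (√δ ^ d)⁻¹ * (4 * Real.pi * 1) ^ (-(d : ℝ) / 2) := by
    rw [Real.mul_rpow (by positivity) hδ.le, mul_one, mul_comm]
    congr 1
    rw [Real.sqrt_eq_rpow, ← Real.rpow_natCast, ← Real.rpow_mul hδ.le, ← Real.rpow_neg hδ.le]
    congr 1; ring
  rw [e1, mul_assoc]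
  congr 3
  rw [norm_smul, norm_inv, Real.norm_of_nonneg hs.le, mul_pow, inv_pow, Real.sq_sqrt hδ.le]
  field_simp

lemma heatMollified_eq {d : ℕ} (hd : 3 ≤ d) (μ : Measure (EuclideanSpace ℝ (Fin d)))
    [IsProbabilityMeasure μ] {δ : ℝ} (hδ : 0 < δ) :
    heatMollified d μ δ = (μ.prod (mm d (heat d 1))).map (fun ω => ω.1 + √δ • ω.2) := by
  have hm := heat_isMollifier hd
  have hpr := hm.prob
  have hcont : Continuous (heat d δ) := by unfold heat; fun_prop
  have hmeas := hcont.measurable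
  have hs : 0 < √δ := Real.sqrt_pos.2 hδ
  have hpi := Real.pi_pos
  have hnn : ∀ x, 0 ≤ heat d δ x := by intro x; unfold heat; positivity
  have hbd : ∀ x, heat d δ x ≤ (4 * Real.pi * δ) ^ (-(d : ℝ) / 2) := by
    intro x; unfold heat
    have : Real.exp (-‖x‖ ^ 2 / (4 * δ)) ≤ 1 := by
      rw [Real.exp_le_one_iff, neg_div]
      have : 0 ≤ ‖x‖ ^ 2 / (4 * δ) := by positivity
      linarith
    exact mul_le_of_le_one_right (by positivity) this
  have e1 : ∀ x, ENNReal.ofReal (∫ y, heat d δ (x - y) ∂μ)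
      = ∫⁻ y, ENNReal.ofReal (heat d δ (x - y)) ∂μ := by
    intro x
    apply ofReal_integral_eq_lintegral_ofReal _ (Eventually.of_forall fun y => hnn _)
    refine Integrable.of_bound (by fun_prop) ((4 * Real.pi * δ) ^ (-(d : ℝ) / 2))
      (Eventually.of_forall fun y => ?_)
    rw [Real.norm_of_nonneg (hnn _)]; exact hbd _
  refine Measure.ext_of_lintegral _ fun f hf => ?_
  rw [lintegral_map hf (by fun_prop), lintegral_prod _ (by fun_prop), heatMollified]
  simp_rw [e1]
  rw [lintegral_withDensity_eq_lintegral_mul _ _ hf]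
  · simp only [Pi.mul_apply]
    calc ∫⁻ x, (∫⁻ y, ENNReal.ofReal (heat d δ (x - y)) ∂μ) * f x
        = ∫⁻ x, ∫⁻ y, ENNReal.ofReal (heat d δ (x - y)) * f x ∂μ := by
          refine lintegral_congr fun x => ?_
          rw [lintegral_mul_const _ (by fun_prop)]
      _ = ∫⁻ y, (∫⁻ x, ENNReal.ofReal (heat d δ (x - y)) * f x) ∂μ := by
          rw [lintegral_lintegral_swap]
          unfold Function.uncurry
          fun_prop
      _ = _ := by
          refine lintegral_congr fun y => ?_
          rw [← lintegral_add_right_eq_self _ y]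
          simp only [add_sub_cancel_right, heat_eq_scaled d hδ]
          rw [lintegral_scaled d (heat d 1) hm.meas hs (fun x => f (x + y)) (by fun_prop)]
          simp_rw [add_comm]
  · apply Measurable.lintegral_prod_right' (f := fun z : EuclideanSpace ℝ (Fin d) × EuclideanSpace ℝ (Fin d) => ENNReal.ofReal (heat d δ (z.1 - z.2)))
    fun_prop

lemma KE_meas (d : ℕ) (p q : ℝ) : Measurable (KE d p q) := by
  unfold KE
  fun_prop

lemma KE_eq {d : ℕ} {p q : ℝ} (hp2 : p < 0) (hq1 : 0 < q) {x : EuclideanSpace ℝ (Fin d)}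
    (hx : x ≠ 0) : KE d p q x = ENNReal.ofReal (Kfun d p q x) := by
  have hx0 : 0 < ‖x‖ := norm_pos_iff.2 hx
  have hp' : 0 < -p := by linarith
  unfold KE Kfun
  rw [nn_eq, ENNReal.ofReal_rpow_of_pos hx0, ENNReal.ofReal_rpow_of_pos hx0,
    ← ENNReal.ofReal_div_of_pos hq1, ← ENNReal.ofReal_div_of_pos hp',
    ← ENNReal.ofReal_add (by positivity) (by positivity)]
  congr 1
  rw [div_neg]; ring

lemma sq_add_le (d : ℕ) (a b : EuclideanSpace ℝ (Fin d)) :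
    (‖a + b‖₊ : ℝ≥0∞) ^ 2 ≤ 2 * (‖a‖₊ : ℝ≥0∞) ^ 2 + 2 * (‖b‖₊ : ℝ≥0∞) ^ 2 := by
  have h : ‖a + b‖₊ ^ 2 ≤ 2 * ‖a‖₊ ^ 2 + 2 * ‖b‖₊ ^ 2 := by
    rw [← NNReal.coe_le_coe]
    push_cast
    have := norm_add_le a b
    nlinarith [norm_nonneg (a + b), sq_nonneg (‖a‖ - ‖b‖)]
  exact_mod_cast h

lemma sq_smul_eq (d : ℕ) (t : ℝ) (a : EuclideanSpace ℝ (Fin d)) :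
    (‖t • a‖₊ : ℝ≥0∞) ^ 2 = (‖t‖₊ : ℝ≥0∞) ^ 2 * (‖a‖₊ : ℝ≥0∞) ^ 2 := by
  rw [nnnorm_smul, ENNReal.coe_mul, mul_pow]

lemma rpow_le_one_add_sq (a : ℝ≥0∞) {q : ℝ} (hq1 : 0 < q) (hq2 : q ≤ 2) :
    a ^ q ≤ 1 + a ^ 2 := by
  rcases le_total a 1 with h | h
  · exact (ENNReal.rpow_le_one h hq1.le).trans le_self_add
  · refine le_trans ?_ le_add_self
    rw [← ENNReal.rpow_two]
    exact ENNReal.rpow_le_rpow_of_exponent_le h hq2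

lemma fin_conv {d : ℕ} (hd : 3 ≤ d) {p q : ℝ} (hp1 : -(d : ℝ) < p) (hp2 : p < 0)
    (hq1 : 0 < q) (hq2 : q ≤ 2) {φ : EuclideanSpace ℝ (Fin d) → ℝ} (hφ : IsMollifier d φ)
    (ε : ℝ) {x : EuclideanSpace ℝ (Fin d)} (hx : x ≠ 0) :
    ∫⁻ y, ∫⁻ z, KE d p q (x - ε • y - ε • z) ∂(mm d φ) ∂(mm d φ) < ⊤ := by
  have hpr := hφ.prob
  have hmom := hφ.moment hd
  set m := ∫⁻ z, (‖z‖₊ : ℝ≥0∞) ^ 2 ∂(mm d φ) with hm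
  obtain ⟨C, hC, hpot⟩ := pot hd hφ p hp1 hp2
  have hp' : 0 < -p := by linarith
  set e : ℝ≥0∞ := (‖-ε‖₊ : ℝ≥0∞) ^ 2 with he
  have hpt : ∀ y z : EuclideanSpace ℝ (Fin d), KE d p q (x - ε • y - ε • z) ≤
      (1 + (4 * (‖x‖₊ : ℝ≥0∞) ^ 2 + 4 * e * (‖y‖₊ : ℝ≥0∞) ^ 2 + 2 * e * (‖z‖₊ : ℝ≥0∞) ^ 2)) *
        (ENNReal.ofReal q)⁻¹
        + (‖(x + (-ε) • y) + (-ε) • z‖₊ : ℝ≥0∞) ^ p * (ENNReal.ofReal (-p))⁻¹ := by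
    intro y z
    have e1 : x - ε • y - ε • z = (x + (-ε) • y) + (-ε) • z := by
      simp only [neg_smul]; abel
    rw [e1, KE, div_eq_mul_inv, div_eq_mul_inv]
    gcongr
    refine (rpow_le_one_add_sq _ hq1 hq2).trans ?_
    gcongr
    refine (sq_add_le d _ _).trans ?_
    rw [sq_smul_eq, ← he]
    have h2 := sq_add_le d x ((-ε) • y)
    rw [sq_smul_eq, ← he] at h2
    calc _ ≤ 2 * (2 * (‖x‖₊ : ℝ≥0∞) ^ 2 + 2 * (e * (‖y‖₊ : ℝ≥0∞) ^ 2)) + 2 * (e * (‖z‖₊ : ℝ≥0∞) ^ 2) := by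
          gcongr
      _ = _ := by ring
  have hqi : (ENNReal.ofReal q)⁻¹ ≠ ⊤ := by simpa using hq1
  have hpi : (ENNReal.ofReal (-p))⁻¹ ≠ ⊤ := by simpa using hp2
  have hin : ∀ y : EuclideanSpace ℝ (Fin d), ∫⁻ z, KE d p q (x - ε • y - ε • z) ∂(mm d φ) ≤
      (1 + (4 * (‖x‖₊ : ℝ≥0∞) ^ 2 + 4 * e * (‖y‖₊ : ℝ≥0∞) ^ 2 + 2 * e * m)) *
        (ENNReal.ofReal q)⁻¹
        + C * (‖x + (-ε) • y‖₊ : ℝ≥0∞) ^ p * (ENNReal.ofReal (-p))⁻¹ := by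
    intro y
    refine (lintegral_mono (hpt y)).trans ?_
    rw [lintegral_add_left (by fun_prop), lintegral_mul_const _ (by fun_prop),
      lintegral_mul_const _ (by fun_prop), lintegral_add_left (by fun_prop),
      lintegral_add_left (by fun_prop), lintegral_const_mul _ (by fun_prop)]
    simp only [lintegral_const, measure_univ, mul_one]
    gcongr
    exact hpot _ _
  refine lt_of_le_of_lt (lintegral_mono hin) ?_
  rw [lintegral_add_left (by fun_prop), lintegral_mul_const _ (by fun_prop),
      lintegral_mul_const _ (by fun_prop), lintegral_const_mul _ (by fun_prop),
      lintegral_add_left (by fun_prop),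
      lintegral_add_right _ (by fun_prop),
      lintegral_add_left (by fun_prop), lintegral_const_mul _ (by fun_prop),
      lintegral_const_mul _ (by fun_prop)]
  simp only [lintegral_const, measure_univ, mul_one]
  have hb : ∫⁻ y, (‖x + (-ε) • y‖₊ : ℝ≥0∞) ^ p ∂(mm d φ) < ⊤ := by
    refine lt_of_le_of_lt (hpot _ _) (ENNReal.mul_lt_top hC.lt_top ?_)
    rw [nn_eq, ENNReal.ofReal_rpow_of_pos (norm_pos_iff.2 hx)]
    exact ENNReal.ofReal_lt_top
  have hee : e < ⊤ := ENNReal.pow_lt_top ENNReal.coe_lt_top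
  have hxx : (‖x‖₊ : ℝ≥0∞) ^ 2 < ⊤ := ENNReal.pow_lt_top ENNReal.coe_lt_top
  have h4 : (4 : ℝ≥0∞) < ⊤ := by norm_num
  have h2 : (2 : ℝ≥0∞) < ⊤ := by norm_num
  refine ENNReal.add_lt_top.2 ⟨ENNReal.mul_lt_top (ENNReal.add_lt_top.2 ⟨ENNReal.one_lt_top,
    ENNReal.add_lt_top.2 ⟨ENNReal.add_lt_top.2 ⟨ENNReal.mul_lt_top h4 hxx,
      ENNReal.mul_lt_top (ENNReal.mul_lt_top h4 hee) hmom⟩,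
      ENNReal.mul_lt_top (ENNReal.mul_lt_top h2 hee) hmom⟩⟩) hqi.lt_top,
    ENNReal.mul_lt_top (ENNReal.mul_lt_top hC.lt_top hb) hpi.lt_top⟩

lemma Kreg_eq {d : ℕ} (hd : 3 ≤ d) {p q : ℝ} (hp1 : -(d : ℝ) < p) (hp2 : p < 0)
    (hq1 : 0 < q) (hq2 : q ≤ 2) {φ : EuclideanSpace ℝ (Fin d) → ℝ} (hφ : IsMollifier d φ)
    {ε : ℝ} (hε : 0 < ε) {x : EuclideanSpace ℝ (Fin d)} (hx : x ≠ 0) :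
    ENNReal.ofReal (Kreg d p q φ ε x) =
    ∫⁻ y, ∫⁻ z, KE d p q (x - ε • y - ε • z) ∂(mm d φ) ∂(mm d φ) := by
  have hpr := hφ.prob
  have hfin := fin_conv hd hp1 hp2 hq1 hq2 hφ ε hx
  have hne : Nonempty (Fin d) := ⟨⟨0, by omega⟩⟩
  have hm := hφ.meas
  have hp' : 0 < -p := by linarith
  have hsm : Measurable (scaled d φ ε) := by unfold scaled; fun_prop
  have hsn : ∀ y, 0 ≤ scaled d φ ε y := fun y => mul_nonneg (by positivity) (hφ.2.2.1 _)
  have hKn : ∀ y, 0 ≤ Kfun d p q y := fun y => by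
    have : Kfun d p q y = ‖y‖ ^ q / q + ‖y‖ ^ p / (-p) := by unfold Kfun; rw [div_neg]; ring
    rw [this]; positivity
  have hKm : Measurable (Kfun d p q) := by unfold Kfun; fun_prop
  have hKEm := KE_meas d p q
  set g : EuclideanSpace ℝ (Fin d) → ℝ≥0∞ := fun y =>
    ∫⁻ z, ENNReal.ofReal (scaled d φ ε y * Kfun d p q (x - y - z) * scaled d φ ε z) with hg
  have hgm : Measurable g := by
    apply Measurable.lintegral_prod_right' (f := fun w : EuclideanSpace ℝ (Fin d) × EuclideanSpace ℝ (Fin d) =>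
      ENNReal.ofReal (scaled d φ ε w.1 * Kfun d p q (x - w.1 - w.2) * scaled d φ ε w.2))
    fun_prop
  have hgeq : ∀ y, g y = ENNReal.ofReal (scaled d φ ε y) *
      ∫⁻ z, KE d p q (x - y - ε • z) ∂(mm d φ) := by
    intro y
    rw [← lintegral_scaled d φ hm hε (fun z => KE d p q (x - y - z)) (by fun_prop),
      ← lintegral_const_mul _ (by fun_prop)]
    refine lintegral_congr_ae ?_
    filter_upwards [Measure.ae_ne (volume : Measure (EuclideanSpace ℝ (Fin d))) (x - y)] with z hz
    rw [KE_eq hp2 hq1 (sub_ne_zero.2 hz.symm), ENNReal.ofReal_mul (mul_nonneg (hsn _) (hKn _)),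
      ENNReal.ofReal_mul (hsn _)]
    ring
  have hgint : ∫⁻ y, g y = ∫⁻ y, ∫⁻ z, KE d p q (x - ε • y - ε • z) ∂(mm d φ) ∂(mm d φ) := by
    simp_rw [hgeq]
    rw [lintegral_scaled d φ hm hε (fun y => ∫⁻ z, KE d p q (x - y - ε • z) ∂(mm d φ))]
    apply Measurable.lintegral_prod_right' (f := fun w : EuclideanSpace ℝ (Fin d) × EuclideanSpace ℝ (Fin d) =>
      KE d p q (x - w.1 - ε • w.2))
    fun_prop
  have hK : Kreg d p q φ ε x = ∫ y, (g y).toReal := by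
    unfold Kreg
    refine integral_congr_ae (Eventually.of_forall fun y => ?_)
    exact integral_eq_lintegral_of_nonneg_ae
      (Eventually.of_forall fun z => mul_nonneg (mul_nonneg (hsn _) (hKn _)) (hsn _))
      (by fun_prop)
  rw [hK, integral_toReal hgm.aemeasurable (ae_lt_top hgm (hgint ▸ hfin.ne)), hgint,
    ENNReal.ofReal_toReal hfin.ne]

/-- The noise measure on the four perturbation variables. -/
noncomputable def Pr (d : ℕ) (φ : EuclideanSpace ℝ (Fin d) → ℝ) :
    Measure ((EuclideanSpace ℝ (Fin d) × EuclideanSpace ℝ (Fin d)) ×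
      (EuclideanSpace ℝ (Fin d) × EuclideanSpace ℝ (Fin d))) :=
  ((mm d (heat d 1)).prod (mm d (heat d 1))).prod ((mm d φ).prod (mm d φ))

/-- The total perturbation. -/
noncomputable def VV (d : ℕ) (s e : ℝ)
    (ω : (EuclideanSpace ℝ (Fin d) × EuclideanSpace ℝ (Fin d)) ×
      (EuclideanSpace ℝ (Fin d) × EuclideanSpace ℝ (Fin d))) : EuclideanSpace ℝ (Fin d) :=
  s • (ω.1.1 - ω.1.2) - e • (ω.2.1 + ω.2.2)

lemma VV_meas (d : ℕ) (s e : ℝ) : Measurable (VV d s e) := by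
  unfold VV; fun_prop

lemma Pr_prob {d : ℕ} (hd : 3 ≤ d) {φ : EuclideanSpace ℝ (Fin d) → ℝ} (hφ : IsMollifier d φ) :
    IsProbabilityMeasure (Pr d φ) := by
  have := hφ.prob
  have := (heat_isMollifier hd).prob
  unfold Pr
  infer_instance

lemma lintegral_Pr {d : ℕ} (hd : 3 ≤ d) {φ : EuclideanSpace ℝ (Fin d) → ℝ} (hφ : IsMollifier d φ)
    (s e : ℝ) (K : EuclideanSpace ℝ (Fin d) → ℝ≥0∞) (hK : Measurable K)
    (x : EuclideanSpace ℝ (Fin d)) :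
    ∫⁻ ω, K (x + VV d s e ω) ∂(Pr d φ) =
    ∫⁻ g, ∫⁻ g', ∫⁻ y, ∫⁻ z, K (x + s • g + (-s) • g' + (-e) • y + (-e) • z)
      ∂(mm d φ) ∂(mm d φ) ∂(mm d (heat d 1)) ∂(mm d (heat d 1)) := by
  have := hφ.prob
  have := (heat_isMollifier hd).prob
  have hV := VV_meas d s e
  have hm1 : Measurable fun ω => K (x + VV d s e ω) := by fun_prop
  unfold Pr
  rw [lintegral_prod _ hm1.aemeasurable, lintegral_prod]
  · refine lintegral_congr fun g => lintegral_congr fun g' => ?_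
    rw [lintegral_prod _ (by fun_prop)]
    refine lintegral_congr fun y => lintegral_congr fun z => ?_
    congr 1
    simp only [VV, smul_sub, smul_add, neg_smul]
    abel
  · exact (Measurable.lintegral_prod_right' hm1).aemeasurable

lemma potV {d : ℕ} (hd : 3 ≤ d) {φ : EuclideanSpace ℝ (Fin d) → ℝ}
    (hφ : IsMollifier d φ) (p : ℝ) (hp : -(d:ℝ) < p) (hp2 : p < 0) :
    ∃ C : ℝ≥0∞, C ≠ ⊤ ∧ ∀ (s e : ℝ) (x : EuclideanSpace ℝ (Fin d)),
      ∫⁻ ω, (‖x + VV d s e ω‖₊ : ℝ≥0∞) ^ p ∂(Pr d φ) ≤ C * (‖x‖₊ : ℝ≥0∞) ^ p := by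
  obtain ⟨C, hC, hb⟩ := pot hd hφ p hp hp2
  obtain ⟨D, hD, hb'⟩ := pot hd (heat_isMollifier hd) p hp hp2
  refine ⟨C * (C * (D * D)), ENNReal.mul_ne_top hC (ENNReal.mul_ne_top hC
    (ENNReal.mul_ne_top hD hD)), fun s e x => ?_⟩
  rw [lintegral_Pr hd hφ s e (fun v => (‖v‖₊ : ℝ≥0∞) ^ p) (meas_pow d p) x]
  calc _ ≤ ∫⁻ g, ∫⁻ g', ∫⁻ y, C * (‖x + s • g + (-s) • g' + (-e) • y‖₊ : ℝ≥0∞) ^ p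
        ∂(mm d φ) ∂(mm d (heat d 1)) ∂(mm d (heat d 1)) := by
        gcongr; exact hb _ _
    _ ≤ ∫⁻ g, ∫⁻ g', C * (C * (‖x + s • g + (-s) • g'‖₊ : ℝ≥0∞) ^ p)
        ∂(mm d (heat d 1)) ∂(mm d (heat d 1)) := by
        gcongr
        rw [lintegral_const_mul _ (by fun_prop)]
        gcongr; exact hb _ _
    _ ≤ ∫⁻ g, C * (C * (D * (‖x + s • g‖₊ : ℝ≥0∞) ^ p)) ∂(mm d (heat d 1)) := by
        gcongr
        rw [lintegral_const_mul _ (by fun_prop), lintegral_const_mul _ (by fun_prop)]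
        gcongr; exact hb' _ _
    _ ≤ C * (C * (D * (D * (‖x‖₊ : ℝ≥0∞) ^ p))) := by
        rw [lintegral_const_mul _ (by fun_prop), lintegral_const_mul _ (by fun_prop),
          lintegral_const_mul _ (by fun_prop)]
        gcongr; exact hb' _ _
    _ = _ := by ring

lemma energy_eq {d : ℕ} (hd : 3 ≤ d) {p q : ℝ} (hp1 : -(d : ℝ) < p) (hp2 : p < 0)
    (hq1 : 0 < q) (hq2 : q ≤ 2) {φ : EuclideanSpace ℝ (Fin d) → ℝ} (hφ : IsMollifier d φ)
    (μ : Measure (EuclideanSpace ℝ (Fin d))) [IsProbabilityMeasure μ]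
    {ε δ : ℝ} (hε : 0 < ε) (hδ : 0 < δ) :
    energyReg d p q φ ε (heatMollified d μ δ) =
    ∫⁻ ξ, ∫⁻ ω, KE d p q (ξ.1 - ξ.2 + VV d (√δ) ε ω) ∂(Pr d φ) ∂(μ.prod μ) := by
  have := hφ.prob
  have := (heat_isMollifier hd).prob
  have := Pr_prob hd hφ
  have hne : Nonempty (Fin d) := ⟨⟨0, by omega⟩⟩
  have hKEm := KE_meas d p q
  have hac : heatMollified d μ δ ≪ volume := withDensity_absolutelyContinuous _ _
  set F : EuclideanSpace ℝ (Fin d) → ℝ≥0∞ := fun v =>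
    ∫⁻ y, ∫⁻ z, KE d p q (v - ε • y - ε • z) ∂(mm d φ) ∂(mm d φ) with hF
  have hFm : Measurable F := by
    have : F = fun v => ∫⁻ y : EuclideanSpace ℝ (Fin d) × EuclideanSpace ℝ (Fin d),
        KE d p q (v - ε • y.1 - ε • y.2) ∂((mm d φ).prod (mm d φ)) := by
      funext v
      rw [lintegral_prod _ (by fun_prop)]
    rw [this]
    apply Measurable.lintegral_prod_right' (f := fun w : EuclideanSpace ℝ (Fin d) ×
      (EuclideanSpace ℝ (Fin d) × EuclideanSpace ℝ (Fin d)) =>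
      KE d p q (w.1 - ε • w.2.1 - ε • w.2.2))
    fun_prop
  set s := √δ with hs
  have step1 : energyReg d p q φ ε (heatMollified d μ δ) =
      ∫⁻ x, ∫⁻ y, F (x - y) ∂(heatMollified d μ δ) ∂(heatMollified d μ δ) := by
    unfold energyReg energyE
    refine lintegral_congr fun x => lintegral_congr_ae ?_
    filter_upwards [hac.ae_le (Measure.ae_ne (volume : Measure (EuclideanSpace ℝ (Fin d))) x)] with y hy
    exact Kreg_eq hd hp1 hp2 hq1 hq2 hφ hε (sub_ne_zero.2 hy.symm)
  have hm2 : Measurable fun w : EuclideanSpace ℝ (Fin d) × EuclideanSpace ℝ (Fin d) => F (w.1 - w.2) := by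
    fun_prop
  rw [step1, heatMollified_eq hd μ hδ]
  rw [lintegral_map (Measurable.lintegral_prod_right' hm2) (by fun_prop)]
  have e2 : ∀ x : EuclideanSpace ℝ (Fin d), ∫⁻ y, F (x - y) ∂((μ.prod (mm d (heat d 1))).map
      (fun ω => ω.1 + √δ • ω.2)) = ∫⁻ y, ∫⁻ g', F (x - (y + s • g')) ∂(mm d (heat d 1)) ∂μ := by
    intro x
    rw [lintegral_map (by fun_prop) (by fun_prop), lintegral_prod _ (by fun_prop)]
  simp_rw [e2]
  have hm3 : Measurable fun w : ((EuclideanSpace ℝ (Fin d) × EuclideanSpace ℝ (Fin d)) × EuclideanSpace ℝ (Fin d)) =>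
      ∫⁻ g', F (w.1.1 + s • w.1.2 - (w.2 + s • g')) ∂(mm d (heat d 1)) := by
    apply Measurable.lintegral_prod_right' (f := fun w :
      ((EuclideanSpace ℝ (Fin d) × EuclideanSpace ℝ (Fin d)) × EuclideanSpace ℝ (Fin d)) ×
      EuclideanSpace ℝ (Fin d) => F (w.1.1.1 + s • w.1.1.2 - (w.1.2 + s • w.2)))
    fun_prop
  rw [lintegral_prod _ (Measurable.lintegral_prod_right' hm3).aemeasurable]
  have hm4 : Measurable fun w : ((EuclideanSpace ℝ (Fin d) × EuclideanSpace ℝ (Fin d)) × _) =>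
      KE d p q (w.1.1 - w.1.2 + VV d s ε w.2) := by
    have := VV_meas d s ε
    fun_prop
  rw [lintegral_prod _ (Measurable.lintegral_prod_right' hm4).aemeasurable]
  refine lintegral_congr fun x => ?_
  rw [lintegral_lintegral_swap]
  · refine lintegral_congr fun y => ?_
    dsimp only
    rw [lintegral_Pr hd hφ s ε (KE d p q) hKEm (x - y)]
    refine lintegral_congr fun g => lintegral_congr fun g' => ?_
    rw [hF]
    refine lintegral_congr fun a => lintegral_congr fun b => ?_
    congr 1
    simp only [neg_smul]
    abel
  · exact (hm3.comp (by fun_prop : Measurable fun w : EuclideanSpace ℝ (Fin d) × EuclideanSpace ℝ (Fin d) =>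
      ((x, w.1), w.2))).aemeasurable


lemma cont_pow (d : ℕ) (p : ℝ) :
    Continuous (fun x : EuclideanSpace ℝ (Fin d) => (‖x‖₊ : ℝ≥0∞) ^ p) :=
  ENNReal.continuous_rpow_const.comp (ENNReal.continuous_coe.comp continuous_nnnorm)

lemma tendsto_VV {d : ℕ} {ι : Type*} {l : Filter ι} {s e : ι → ℝ}
    (hs : Tendsto s l (𝓝 0)) (he : Tendsto e l (𝓝 0)) (x : EuclideanSpace ℝ (Fin d)) (ω) :
    Tendsto (fun i => x + VV d (s i) (e i) ω) l (𝓝 x) := by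
  have h := (hs.smul_const (ω.1.1 - ω.1.2)).sub (he.smul_const (ω.2.1 + ω.2.2))
  have h2 := h.const_add x
  simpa [VV] using h2

lemma split_ineq (a η : ℝ≥0∞) (hη : η ≠ 0) (hηt : η ≠ ⊤) {p : ℝ} (hp : p < 0) :
    a ^ p ≤ min (a ^ p) (η ^ p) + η * a ^ (p - 1) := by
  rcases le_or_gt η a with h | h
  · refine le_trans ?_ le_self_add
    have e : ∀ b : ℝ≥0∞, b ^ p = (b ^ (-p))⁻¹ := fun b => by rw [← ENNReal.rpow_neg, neg_neg]
    refine le_min le_rfl ?_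
    rw [e a, e η]
    exact ENNReal.inv_le_inv.2 (ENNReal.rpow_le_rpow h (by linarith))
  · refine le_trans ?_ le_add_self
    by_cases ha : a = 0
    · subst ha
      rw [ENNReal.zero_rpow_of_neg (by linarith : p - 1 < 0), ENNReal.mul_top hη]
      exact le_top
    · have hat : a ≠ ⊤ := (h.trans_le le_top).ne
      calc a ^ p = a ^ (1 + (p - 1)) := by ring_nf
        _ = a * a ^ (p - 1) := by rw [ENNReal.rpow_add _ _ ha hat, ENNReal.rpow_one]
        _ ≤ _ := by gcongr

lemma R_pointwise {d : ℕ} (hd : 3 ≤ d) {φ : EuclideanSpace ℝ (Fin d) → ℝ}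
    (hφ : IsMollifier d φ) {p : ℝ} (hp1 : -(d:ℝ) < p - 1) (hp2 : p < 0)
    {ι : Type*} {l : Filter ι} [l.NeBot] [l.IsCountablyGenerated] {s e : ι → ℝ}
    (hs : Tendsto s l (𝓝 0)) (he : Tendsto e l (𝓝 0)) (x : EuclideanSpace ℝ (Fin d)) :
    Tendsto (fun i => ∫⁻ ω, (‖x + VV d (s i) (e i) ω‖₊ : ℝ≥0∞) ^ p ∂(Pr d φ)) l
      (𝓝 ((‖x‖₊ : ℝ≥0∞) ^ p)) := by
  have hpr := Pr_prob hd hφ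
  have hpt : ∀ ω, Tendsto (fun i => (‖x + VV d (s i) (e i) ω‖₊ : ℝ≥0∞) ^ p) l
      (𝓝 ((‖x‖₊ : ℝ≥0∞) ^ p)) := fun ω =>
    ((cont_pow d p).tendsto x).comp (tendsto_VV hs he x ω)
  have hm : ∀ i, Measurable fun ω => (‖x + VV d (s i) (e i) ω‖₊ : ℝ≥0∞) ^ p := by
    intro i
    have := VV_meas d (s i) (e i)
    fun_prop
  have hlow : (‖x‖₊ : ℝ≥0∞) ^ p ≤
      liminf (fun i => ∫⁻ ω, (‖x + VV d (s i) (e i) ω‖₊ : ℝ≥0∞) ^ p ∂(Pr d φ)) l := by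
    refine le_trans (le_of_eq ?_) (lintegral_liminf_le hm)
    simp_rw [fun ω => (hpt ω).liminf_eq]
    simp
  refine tendsto_of_le_liminf_of_limsup_le hlow ?_
  by_cases hx : x = 0
  · subst hx
    simp only [nnnorm_zero, ENNReal.coe_zero, ENNReal.zero_rpow_of_neg hp2]
    exact le_top
  obtain ⟨C, hC, hb⟩ := potV hd hφ (p - 1) hp1 (by linarith)
  set D : ℝ≥0∞ := C * (‖x‖₊ : ℝ≥0∞) ^ (p - 1) with hD
  have hDt : D ≠ ⊤ := by
    refine ENNReal.mul_ne_top hC ?_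
    rw [nn_eq, ENNReal.ofReal_rpow_of_pos (norm_pos_iff.2 hx)]
    exact ENNReal.ofReal_ne_top
  have hη : ∀ η : ℝ, 0 < η →
      limsup (fun i => ∫⁻ ω, (‖x + VV d (s i) (e i) ω‖₊ : ℝ≥0∞) ^ p ∂(Pr d φ)) l ≤
      (‖x‖₊ : ℝ≥0∞) ^ p + ENNReal.ofReal η * D := by
    intro η hη
    set N : ℝ≥0∞ := (ENNReal.ofReal η) ^ p with hN
    have hNt : N ≠ ⊤ := by
      rw [hN, ENNReal.ofReal_rpow_of_pos hη]; exact ENNReal.ofReal_ne_top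
    have hlim : Tendsto (fun i => ∫⁻ ω, min ((‖x + VV d (s i) (e i) ω‖₊ : ℝ≥0∞) ^ p) N ∂(Pr d φ)) l
        (𝓝 (∫⁻ ω, min ((‖x‖₊ : ℝ≥0∞) ^ p) N ∂(Pr d φ))) := by
      refine tendsto_lintegral_filter_of_dominated_convergence (fun _ => N)
        (Eventually.of_forall fun i => (hm i).min measurable_const)
        (Eventually.of_forall fun i => Eventually.of_forall fun ω => min_le_right _ _)
        (by simpa using hNt)
        (Eventually.of_forall fun ω => (hpt ω).min tendsto_const_nhds)
    have hlim2 := hlim.add (tendsto_const_nhds (x := ENNReal.ofReal η * D))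
    calc _ ≤ limsup (fun i => ∫⁻ ω, min ((‖x + VV d (s i) (e i) ω‖₊ : ℝ≥0∞) ^ p) N ∂(Pr d φ)
            + ENNReal.ofReal η * D) l := by
          refine limsup_le_limsup (Eventually.of_forall fun i => ?_)
          have hmV := VV_meas d (s i) (e i)
          calc ∫⁻ ω, (‖x + VV d (s i) (e i) ω‖₊ : ℝ≥0∞) ^ p ∂(Pr d φ)
              ≤ ∫⁻ ω, (min ((‖x + VV d (s i) (e i) ω‖₊ : ℝ≥0∞) ^ p) N
                + ENNReal.ofReal η * (‖x + VV d (s i) (e i) ω‖₊ : ℝ≥0∞) ^ (p - 1)) ∂(Pr d φ) :=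
                lintegral_mono fun ω => split_ineq _ _ (by simpa using hη) ENNReal.ofReal_ne_top hp2
            _ = ∫⁻ ω, min ((‖x + VV d (s i) (e i) ω‖₊ : ℝ≥0∞) ^ p) N ∂(Pr d φ)
                + ENNReal.ofReal η * ∫⁻ ω, (‖x + VV d (s i) (e i) ω‖₊ : ℝ≥0∞) ^ (p - 1) ∂(Pr d φ) := by
                rw [lintegral_add_left ((hm i).min measurable_const),
                  lintegral_const_mul _ (by fun_prop)]
            _ ≤ _ := add_le_add le_rfl (mul_le_mul' le_rfl (hb _ _ _))
      _ = ∫⁻ ω, min ((‖x‖₊ : ℝ≥0∞) ^ p) N ∂(Pr d φ) + ENNReal.ofReal η * D := hlim2.limsup_eq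
      _ ≤ _ := by
          gcongr
          simp
  have hlimη : Tendsto (fun η : ℝ => (‖x‖₊ : ℝ≥0∞) ^ p + ENNReal.ofReal η * D) (𝓝[>] 0)
      (𝓝 ((‖x‖₊ : ℝ≥0∞) ^ p + ENNReal.ofReal 0 * D)) := by
    refine Tendsto.const_add _ (ENNReal.Tendsto.mul_const ?_ (Or.inr hDt))
    exact (ENNReal.continuous_ofReal.tendsto 0).mono_left nhdsWithin_le_nhds
  simp only [ENNReal.ofReal_zero, zero_mul, add_zero] at hlimη
  refine ge_of_tendsto hlimη ?_
  filter_upwards [self_mem_nhdsWithin] with η h using hη η h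

lemma R_global {d : ℕ} (hd : 3 ≤ d) {φ : EuclideanSpace ℝ (Fin d) → ℝ}
    (hφ : IsMollifier d φ) {p : ℝ} (hp1 : -(d:ℝ) < p - 1) (hp2 : p < 0)
    (μ : Measure (EuclideanSpace ℝ (Fin d))) [IsProbabilityMeasure μ]
    {ι : Type*} {l : Filter ι} [l.NeBot] [l.IsCountablyGenerated] {s e : ι → ℝ}
    (hs : Tendsto s l (𝓝 0)) (he : Tendsto e l (𝓝 0)) :
    Tendsto (fun i => ∫⁻ ξ, ∫⁻ ω, (‖ξ.1 - ξ.2 + VV d (s i) (e i) ω‖₊ : ℝ≥0∞) ^ p ∂(Pr d φ)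
      ∂(μ.prod μ)) l (𝓝 (∫⁻ ξ, (‖ξ.1 - ξ.2‖₊ : ℝ≥0∞) ^ p ∂(μ.prod μ))) := by
  have hpr := Pr_prob hd hφ
  have hm : ∀ i, Measurable fun ξ : EuclideanSpace ℝ (Fin d) × EuclideanSpace ℝ (Fin d) =>
      ∫⁻ ω, (‖ξ.1 - ξ.2 + VV d (s i) (e i) ω‖₊ : ℝ≥0∞) ^ p ∂(Pr d φ) := by
    intro i
    have := VV_meas d (s i) (e i)
    apply Measurable.lintegral_prod_right' (f := fun w :
      (EuclideanSpace ℝ (Fin d) × EuclideanSpace ℝ (Fin d)) × _ =>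
      (‖w.1.1 - w.1.2 + VV d (s i) (e i) w.2‖₊ : ℝ≥0∞) ^ p)
    fun_prop
  have hpt := fun ξ : EuclideanSpace ℝ (Fin d) × EuclideanSpace ℝ (Fin d) =>
    R_pointwise hd hφ hp1 hp2 hs he (ξ.1 - ξ.2)
  by_cases htop : ∫⁻ ξ, (‖ξ.1 - ξ.2‖₊ : ℝ≥0∞) ^ p ∂(μ.prod μ) = ⊤
  · refine tendsto_of_le_liminf_of_limsup_le ?_ (htop ▸ le_top)
    refine le_trans (le_of_eq ?_) (lintegral_liminf_le hm)
    refine lintegral_congr fun ξ => ((hpt ξ).liminf_eq).symm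
  · obtain ⟨C, hC, hb⟩ := potV hd hφ p (by linarith) hp2
    refine tendsto_lintegral_filter_of_dominated_convergence
      (fun ξ => C * (‖ξ.1 - ξ.2‖₊ : ℝ≥0∞) ^ p)
      (Eventually.of_forall hm)
      (Eventually.of_forall fun i => Eventually.of_forall fun ξ => hb _ _ _) ?_
      (Eventually.of_forall hpt)
    rw [lintegral_const_mul _ (by fun_prop)]
    exact ENNReal.mul_ne_top hC htop

lemma lint_fst {α β : Type*} [MeasurableSpace α] [MeasurableSpace β] (μ : Measure α)
    (ν : Measure β) [IsProbabilityMeasure μ] [IsProbabilityMeasure ν] {f : α → ℝ≥0∞}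
    (hf : Measurable f) : ∫⁻ ω, f ω.1 ∂(μ.prod ν) = ∫⁻ x, f x ∂μ :=
  measurePreserving_fst.lintegral_comp hf

lemma lint_snd {α β : Type*} [MeasurableSpace α] [MeasurableSpace β] (μ : Measure α)
    (ν : Measure β) [IsProbabilityMeasure μ] [IsProbabilityMeasure ν] {f : β → ℝ≥0∞}
    (hf : Measurable f) : ∫⁻ ω, f ω.2 ∂(μ.prod ν) = ∫⁻ x, f x ∂ν :=
  measurePreserving_snd.lintegral_comp hf

lemma sq_sub_le (d : ℕ) (a b : EuclideanSpace ℝ (Fin d)) :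
    (‖a - b‖₊ : ℝ≥0∞) ^ 2 ≤ 2 * (‖a‖₊ : ℝ≥0∞) ^ 2 + 2 * (‖b‖₊ : ℝ≥0∞) ^ 2 := by
  have := sq_add_le d a (-b)
  rwa [nnnorm_neg, ← sub_eq_add_neg] at this

lemma sq_smul_le (d : ℕ) {t : ℝ} (ht : |t| ≤ 1) (a : EuclideanSpace ℝ (Fin d)) :
    (‖t • a‖₊ : ℝ≥0∞) ^ 2 ≤ (‖a‖₊ : ℝ≥0∞) ^ 2 := by
  gcongr
  rw [← NNReal.coe_le_coe, coe_nnnorm, coe_nnnorm, norm_smul, Real.norm_eq_abs]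
  exact mul_le_of_le_one_left (norm_nonneg _) ht

lemma A_global {d : ℕ} (hd : 3 ≤ d) {φ : EuclideanSpace ℝ (Fin d) → ℝ}
    (hφ : IsMollifier d φ) {q : ℝ} (hq1 : 0 < q) (hq2 : q ≤ 2)
    (μ : Measure (EuclideanSpace ℝ (Fin d))) [IsProbabilityMeasure μ]
    (hmu : ∫⁻ x, (‖x‖₊ : ℝ≥0∞) ^ 2 ∂μ < ⊤)
    {ι : Type*} {l : Filter ι} [l.NeBot] [l.IsCountablyGenerated] {s e : ι → ℝ}
    (hs : Tendsto s l (𝓝 0)) (he : Tendsto e l (𝓝 0)) :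
    Tendsto (fun i => ∫⁻ ξ, ∫⁻ ω, (‖ξ.1 - ξ.2 + VV d (s i) (e i) ω‖₊ : ℝ≥0∞) ^ q ∂(Pr d φ)
      ∂(μ.prod μ)) l (𝓝 (∫⁻ ξ, (‖ξ.1 - ξ.2‖₊ : ℝ≥0∞) ^ q ∂(μ.prod μ))) := by
  have hpr := Pr_prob hd hφ
  have hp1 := hφ.prob
  have hp2 := (heat_isMollifier hd).prob
  have hmom1 := hφ.moment hd
  have hmom2 := (heat_isMollifier hd).moment hd
  have hmeasi : ∀ i, Measurable fun w : (EuclideanSpace ℝ (Fin d) × EuclideanSpace ℝ (Fin d)) × _ =>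
      (‖w.1.1 - w.1.2 + VV d (s i) (e i) w.2‖₊ : ℝ≥0∞) ^ q := by
    intro i
    have := VV_meas d (s i) (e i)
    fun_prop
  have e1 : ∀ i, ∫⁻ ξ, ∫⁻ ω, (‖ξ.1 - ξ.2 + VV d (s i) (e i) ω‖₊ : ℝ≥0∞) ^ q ∂(Pr d φ)
      ∂(μ.prod μ) = ∫⁻ w, (‖w.1.1 - w.1.2 + VV d (s i) (e i) w.2‖₊ : ℝ≥0∞) ^ q
        ∂((μ.prod μ).prod (Pr d φ)) := by
    intro i
    rw [lintegral_prod _ (hmeasi i).aemeasurable]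
  have e2 : ∫⁻ ξ, (‖ξ.1 - ξ.2‖₊ : ℝ≥0∞) ^ q ∂(μ.prod μ) =
      ∫⁻ w, (‖w.1.1 - w.1.2‖₊ : ℝ≥0∞) ^ q ∂((μ.prod μ).prod (Pr d φ)) :=
    (lint_fst (μ.prod μ) (Pr d φ) (f := fun ξ => (‖ξ.1 - ξ.2‖₊ : ℝ≥0∞) ^ q) (by fun_prop)).symm
  simp_rw [e1]
  rw [e2]
  refine tendsto_lintegral_filter_of_dominated_convergence
    (fun w => 1 + (2 * (2 * (‖w.1.1‖₊ : ℝ≥0∞) ^ 2 + 2 * (‖w.1.2‖₊ : ℝ≥0∞) ^ 2)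
      + 2 * (2 * (2 * (‖w.2.1.1‖₊ : ℝ≥0∞) ^ 2 + 2 * (‖w.2.1.2‖₊ : ℝ≥0∞) ^ 2)
        + 2 * (2 * (‖w.2.2.1‖₊ : ℝ≥0∞) ^ 2 + 2 * (‖w.2.2.2‖₊ : ℝ≥0∞) ^ 2))))
    (Eventually.of_forall hmeasi) ?_ ?_ ?_
  · have hs1 : ∀ᶠ i in l, |s i| ≤ 1 := by
      filter_upwards [hs.eventually (Metric.ball_mem_nhds 0 one_pos)] with i hi
      simpa using (le_of_lt hi)
    have he1 : ∀ᶠ i in l, |e i| ≤ 1 := by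
      filter_upwards [he.eventually (Metric.ball_mem_nhds 0 one_pos)] with i hi
      simpa using (le_of_lt hi)
    filter_upwards [hs1, he1] with i hi1 hi2
    refine Eventually.of_forall fun w => ?_
    refine (rpow_le_one_add_sq _ hq1 hq2).trans ?_
    gcongr
    refine (sq_add_le d _ _).trans ?_
    gcongr
    · exact sq_sub_le d _ _
    · unfold VV
      refine (sq_sub_le d _ _).trans ?_
      gcongr
      · exact (sq_smul_le d hi1 _).trans (sq_sub_le d _ _)
      · exact (sq_smul_le d hi2 _).trans (sq_add_le d _ _)
  · have f1 : ∫⁻ w, (‖w.1.1‖₊ : ℝ≥0∞) ^ 2 ∂((μ.prod μ).prod (Pr d φ)) < ⊤ := by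
      rw [lint_fst (μ.prod μ) (Pr d φ) (f := fun ξ => (‖ξ.1‖₊ : ℝ≥0∞) ^ 2) (by fun_prop),
        lint_fst μ μ (f := fun x => (‖x‖₊ : ℝ≥0∞) ^ 2) (by fun_prop)]
      exact hmu
    have f2 : ∫⁻ w, (‖w.1.2‖₊ : ℝ≥0∞) ^ 2 ∂((μ.prod μ).prod (Pr d φ)) < ⊤ := by
      rw [lint_fst (μ.prod μ) (Pr d φ) (f := fun ξ => (‖ξ.2‖₊ : ℝ≥0∞) ^ 2) (by fun_prop),
        lint_snd μ μ (f := fun x => (‖x‖₊ : ℝ≥0∞) ^ 2) (by fun_prop)]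
      exact hmu
    have f3 : ∫⁻ w, (‖w.2.1.1‖₊ : ℝ≥0∞) ^ 2 ∂((μ.prod μ).prod (Pr d φ)) < ⊤ := by
      rw [lint_snd (μ.prod μ) (Pr d φ) (f := fun ξ => (‖ξ.1.1‖₊ : ℝ≥0∞) ^ 2) (by fun_prop), Pr,
        lint_fst ((mm d (heat d 1)).prod (mm d (heat d 1))) ((mm d φ).prod (mm d φ)) (f := fun x => (‖x.1‖₊ : ℝ≥0∞) ^ 2) (by fun_prop),
        lint_fst (mm d (heat d 1)) (mm d (heat d 1)) (f := fun x => (‖x‖₊ : ℝ≥0∞) ^ 2) (by fun_prop)]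
      exact hmom2
    have f4 : ∫⁻ w, (‖w.2.1.2‖₊ : ℝ≥0∞) ^ 2 ∂((μ.prod μ).prod (Pr d φ)) < ⊤ := by
      rw [lint_snd (μ.prod μ) (Pr d φ) (f := fun ξ => (‖ξ.1.2‖₊ : ℝ≥0∞) ^ 2) (by fun_prop), Pr,
        lint_fst ((mm d (heat d 1)).prod (mm d (heat d 1))) ((mm d φ).prod (mm d φ)) (f := fun x => (‖x.2‖₊ : ℝ≥0∞) ^ 2) (by fun_prop),
        lint_snd (mm d (heat d 1)) (mm d (heat d 1)) (f := fun x => (‖x‖₊ : ℝ≥0∞) ^ 2) (by fun_prop)]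
      exact hmom2
    have f5 : ∫⁻ w, (‖w.2.2.1‖₊ : ℝ≥0∞) ^ 2 ∂((μ.prod μ).prod (Pr d φ)) < ⊤ := by
      rw [lint_snd (μ.prod μ) (Pr d φ) (f := fun ξ => (‖ξ.2.1‖₊ : ℝ≥0∞) ^ 2) (by fun_prop), Pr,
        lint_snd ((mm d (heat d 1)).prod (mm d (heat d 1))) ((mm d φ).prod (mm d φ)) (f := fun x => (‖x.1‖₊ : ℝ≥0∞) ^ 2) (by fun_prop),
        lint_fst (mm d φ) (mm d φ) (f := fun x => (‖x‖₊ : ℝ≥0∞) ^ 2) (by fun_prop)]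
      exact hmom1
    have f6 : ∫⁻ w, (‖w.2.2.2‖₊ : ℝ≥0∞) ^ 2 ∂((μ.prod μ).prod (Pr d φ)) < ⊤ := by
      rw [lint_snd (μ.prod μ) (Pr d φ) (f := fun ξ => (‖ξ.2.2‖₊ : ℝ≥0∞) ^ 2) (by fun_prop), Pr,
        lint_snd ((mm d (heat d 1)).prod (mm d (heat d 1))) ((mm d φ).prod (mm d φ)) (f := fun x => (‖x.2‖₊ : ℝ≥0∞) ^ 2) (by fun_prop),
        lint_snd (mm d φ) (mm d φ) (f := fun x => (‖x‖₊ : ℝ≥0∞) ^ 2) (by fun_prop)]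
      exact hmom1
    have comb : ∀ {α : Type _} [MeasurableSpace α] (m : Measure α) (f g : α → ℝ≥0∞),
        Measurable f → Measurable g → ∫⁻ w, f w ∂m < ⊤ → ∫⁻ w, g w ∂m < ⊤ →
        ∫⁻ w, (2 * f w + 2 * g w) ∂m < ⊤ := by
      intro α _ m f g hf hg h1 h2
      rw [lintegral_add_left (by fun_prop), lintegral_const_mul _ hf, lintegral_const_mul _ hg]
      exact ENNReal.add_lt_top.2 ⟨ENNReal.mul_lt_top (by norm_num) h1,
        ENNReal.mul_lt_top (by norm_num) h2⟩
    refine LT.lt.ne ?_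
    rw [lintegral_add_left measurable_const]
    refine ENNReal.add_lt_top.2 ⟨by simp, ?_⟩
    exact comb _ _ _ (by fun_prop) (by fun_prop)
      (comb _ _ _ (by fun_prop) (by fun_prop) f1 f2)
      (comb _ _ _ (by fun_prop) (by fun_prop)
        (comb _ _ _ (by fun_prop) (by fun_prop) f3 f4)
        (comb _ _ _ (by fun_prop) (by fun_prop) f5 f6))
  · exact Eventually.of_forall fun w =>
      ((cont_pow d q).tendsto _).comp (tendsto_VV hs he _ _)

lemma weak_part {d : ℕ} (hd : 3 ≤ d) (μ : Measure (EuclideanSpace ℝ (Fin d)))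
    [IsProbabilityMeasure μ] {ι : Type*} {l : Filter ι} [l.IsCountablyGenerated]
    {δ : ι → ℝ} (hδ : ∀ᶠ i in l, 0 < δ i) (hs : Tendsto (fun i => √(δ i)) l (𝓝 0))
    {f : EuclideanSpace ℝ (Fin d) → ℝ} (hf : Continuous f) {M : ℝ} (hM : ∀ x, |f x| ≤ M) :
    Tendsto (fun i => ∫ x, f x ∂(heatMollified d μ (δ i))) l (𝓝 (∫ x, f x ∂μ)) := by
  have hp2 := (heat_isMollifier hd).prob
  have e0 : ∫ x, f x ∂μ = ∫ ω, f ω.1 ∂(μ.prod (mm d (heat d 1))) := by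
    rw [integral_fun_fst]; simp
  rw [e0]
  refine Tendsto.congr' (f₁ := fun i => ∫ ω, f (ω.1 + √(δ i) • ω.2) ∂(μ.prod (mm d (heat d 1)))) ?_ ?_
  · filter_upwards [hδ] with i hi
    rw [heatMollified_eq hd μ hi, integral_map (by fun_prop) hf.aestronglyMeasurable]
  · refine tendsto_integral_filter_of_dominated_convergence (fun _ => M)
      (Eventually.of_forall fun i => ?_)
      (Eventually.of_forall fun i => Eventually.of_forall fun ω => hM _)
      (integrable_const _) (Eventually.of_forall fun ω => ?_)
    · exact (hf.comp (by fun_prop)).aestronglyMeasurable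
    · refine (hf.tendsto _).comp ?_
      simpa using (hs.smul_const ω.2).const_add ω.1

lemma moment_part {d : ℕ} (hd : 3 ≤ d) (μ : Measure (EuclideanSpace ℝ (Fin d)))
    [IsProbabilityMeasure μ] (hmu : ∫⁻ x, (‖x‖₊ : ℝ≥0∞) ^ 2 ∂μ < ⊤)
    {ι : Type*} {l : Filter ι} [l.IsCountablyGenerated]
    {δ : ι → ℝ} (hδ : ∀ᶠ i in l, 0 < δ i) (hs : Tendsto (fun i => √(δ i)) l (𝓝 0)) :
    Tendsto (fun i => ∫⁻ x, (‖x‖₊ : ℝ≥0∞) ^ 2 ∂(heatMollified d μ (δ i))) l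
      (𝓝 (∫⁻ x, (‖x‖₊ : ℝ≥0∞) ^ 2 ∂μ)) := by
  have hp2 := (heat_isMollifier hd).prob
  have hmom2 := (heat_isMollifier hd).moment hd
  have hc : Continuous fun x : EuclideanSpace ℝ (Fin d) => (‖x‖₊ : ℝ≥0∞) ^ 2 :=
    (ENNReal.continuous_pow 2).comp (ENNReal.continuous_coe.comp continuous_nnnorm)
  rw [← lint_fst μ (mm d (heat d 1)) hc.measurable]
  refine Tendsto.congr' (f₁ := fun i =>
    ∫⁻ ω, (‖ω.1 + √(δ i) • ω.2‖₊ : ℝ≥0∞) ^ 2 ∂(μ.prod (mm d (heat d 1)))) ?_ ?_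
  · filter_upwards [hδ] with i hi
    rw [heatMollified_eq hd μ hi, lintegral_map (by fun_prop) (by fun_prop)]
  · refine tendsto_lintegral_filter_of_dominated_convergence
      (fun ω => 2 * (‖ω.1‖₊ : ℝ≥0∞) ^ 2 + 2 * (‖ω.2‖₊ : ℝ≥0∞) ^ 2)
      (Eventually.of_forall fun i => by fun_prop) ?_ ?_ (Eventually.of_forall fun ω => ?_)
    · filter_upwards [hs.eventually (Metric.ball_mem_nhds 0 one_pos)] with i hi
      have hi' : |√(δ i)| ≤ 1 := by simpa using (le_of_lt hi)
      refine Eventually.of_forall fun ω => (sq_add_le d _ _).trans ?_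
      exact add_le_add le_rfl (mul_le_mul' le_rfl (sq_smul_le d hi' _))
    · rw [lintegral_add_left (by fun_prop), lintegral_const_mul _ (by fun_prop),
        lintegral_const_mul _ (by fun_prop), lint_fst μ (mm d (heat d 1)) hc.measurable,
        lint_snd μ (mm d (heat d 1)) hc.measurable]
      exact (ENNReal.add_lt_top.2 ⟨ENNReal.mul_lt_top (by norm_num) hmu,
        ENNReal.mul_lt_top (by norm_num) hmom2⟩).ne
    · refine (hc.tendsto _).comp ?_
      simpa using (hs.smul_const ω.2).const_add ω.1

lemma energy_part {d : ℕ} (hd : 3 ≤ d) {p q : ℝ} (hp1 : 2 - (d : ℝ) ≤ p) (hp2 : p < 0)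
    (hq1 : 0 < q) (hq2 : q ≤ 2)
    {φ : EuclideanSpace ℝ (Fin d) → ℝ} (hφ : IsMollifier d φ)
    (μ : Measure (EuclideanSpace ℝ (Fin d)))
    [IsProbabilityMeasure μ] (hmu : ∫⁻ x, (‖x‖₊ : ℝ≥0∞) ^ 2 ∂μ < ⊤)
    {ι : Type*} {l : Filter ι} [l.NeBot] [l.IsCountablyGenerated]
    {δ e : ι → ℝ} (hδ : ∀ᶠ i in l, 0 < δ i) (hs : Tendsto (fun i => √(δ i)) l (𝓝 0))
    (he0 : ∀ᶠ i in l, 0 < e i) (he : Tendsto e l (𝓝 0)) :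
    Tendsto (fun i => energyReg d p q φ (e i) (heatMollified d μ (δ i))) l
      (𝓝 (energyE d (KE d p q) μ)) := by
  have hpr := Pr_prob hd hφ
  have hA := A_global hd hφ hq1 hq2 μ hmu hs he
  have hR := R_global hd hφ (p := p) (by linarith) hp2 μ hs he
  have hqt : (ENNReal.ofReal q)⁻¹ ≠ ⊤ := by simpa using hq1
  have hpt : (ENNReal.ofReal (-p))⁻¹ ≠ ⊤ := by simpa using hp2
  have hT := (ENNReal.Tendsto.mul_const hA (Or.inr hqt)).add
    (ENNReal.Tendsto.mul_const hR (Or.inr hpt))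
  have e0 : energyE d (KE d p q) μ =
      (∫⁻ ξ, (‖ξ.1 - ξ.2‖₊ : ℝ≥0∞) ^ q ∂(μ.prod μ)) * (ENNReal.ofReal q)⁻¹ +
      (∫⁻ ξ, (‖ξ.1 - ξ.2‖₊ : ℝ≥0∞) ^ p ∂(μ.prod μ)) * (ENNReal.ofReal (-p))⁻¹ := by
    have hK := KE_meas d p q
    rw [energyE, ← lintegral_prod (fun ξ : EuclideanSpace ℝ (Fin d) × EuclideanSpace ℝ (Fin d) =>
      KE d p q (ξ.1 - ξ.2)) (by fun_prop),
      ← lintegral_mul_const _ (by fun_prop), ← lintegral_mul_const _ (by fun_prop),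
      ← lintegral_add_left (by fun_prop)]
    rfl
  rw [e0]
  refine hT.congr' ?_
  filter_upwards [hδ, he0] with i h1 h2
  have hm : ∀ r : ℝ, Measurable fun ξ : EuclideanSpace ℝ (Fin d) × EuclideanSpace ℝ (Fin d) =>
      ∫⁻ ω, (‖ξ.1 - ξ.2 + VV d (√(δ i)) (e i) ω‖₊ : ℝ≥0∞) ^ r ∂(Pr d φ) := by
    intro r
    have := VV_meas d (√(δ i)) (e i)
    apply Measurable.lintegral_prod_right' (f := fun w :
      (EuclideanSpace ℝ (Fin d) × EuclideanSpace ℝ (Fin d)) × _ =>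
      (‖w.1.1 - w.1.2 + VV d (√(δ i)) (e i) w.2‖₊ : ℝ≥0∞) ^ r)
    fun_prop
  rw [energy_eq hd (by linarith) hp2 hq1 hq2 hφ μ h2 h1,
    ← lintegral_mul_const _ (hm q), ← lintegral_mul_const _ (hm p),
    ← lintegral_add_left ((hm q).mul_const _)]
  refine lintegral_congr fun ξ => ?_
  have hV := VV_meas d (√(δ i)) (e i)
  rw [← lintegral_mul_const _ (by fun_prop), ← lintegral_mul_const _ (by fun_prop),
    ← lintegral_add_left (by fun_prop)]
  rfl

/-- Recovery sequence: for `μ ∈ P₂(ℝ^d)`, the measures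
`ν_ε = μ * ψ_{δ(ε)}` with `δ(ε) = ε^{1/(2d)}` converge to `μ` in the `2`-Wasserstein sense
(weak-* convergence plus convergence of second moments) and `E_ε(ν_ε) → E(μ)` as `ε → 0`. -/
theorem recovery_sequence
    (d : ℕ) (hd : 3 ≤ d) (p q : ℝ) (hp1 : 2 - (d : ℝ) ≤ p) (hp2 : p < 0)
    (hq1 : 0 < q) (hq2 : q ≤ 2)
    (φ : EuclideanSpace ℝ (Fin d) → ℝ) (hφ : IsMollifier d φ)
    (μ : Measure (EuclideanSpace ℝ (Fin d))) (hμ : IsP2 d μ) :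
    (∀ f : EuclideanSpace ℝ (Fin d) → ℝ, Continuous f → (∃ M : ℝ, ∀ x, |f x| ≤ M) →
      Tendsto (fun ε : ℝ => ∫ x, f x ∂(heatMollified d μ (ε ^ (1 / (2 * (d : ℝ))))))
        (𝓝[>] 0) (𝓝 (∫ x, f x ∂μ))) ∧
    Tendsto (fun ε : ℝ =>
        ∫⁻ x, (‖x‖₊ : ℝ≥0∞) ^ 2 ∂(heatMollified d μ (ε ^ (1 / (2 * (d : ℝ))))))
      (𝓝[>] 0) (𝓝 (∫⁻ x, (‖x‖₊ : ℝ≥0∞) ^ 2 ∂μ)) ∧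
    Tendsto (fun ε : ℝ =>
        energyReg d p q φ ε (heatMollified d μ (ε ^ (1 / (2 * (d : ℝ))))))
      (𝓝[>] 0) (𝓝 (energyE d (KE d p q) μ)) := by

  obtain ⟨hprob, hmom⟩ := hμ
  have hd0 : (0:ℝ) < 1 / (2 * (d:ℝ)) := by
    have : (0:ℝ) < d := by exact_mod_cast (by omega : 0 < d)
    positivity
  have he0 : ∀ᶠ ε : ℝ in 𝓝[>] 0, 0 < ε := self_mem_nhdsWithin
  have he : Tendsto (fun ε : ℝ => ε) (𝓝[>] 0) (𝓝 0) := tendsto_id.mono_left nhdsWithin_le_nhds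
  have hδ : ∀ᶠ ε : ℝ in 𝓝[>] 0, 0 < ε ^ (1 / (2 * (d : ℝ))) := by
    filter_upwards [he0] with ε h using Real.rpow_pos_of_pos h _
  have hs : Tendsto (fun ε : ℝ => √(ε ^ (1 / (2 * (d : ℝ))))) (𝓝[>] 0) (𝓝 0) := by
    have h1 : Tendsto (fun ε : ℝ => √(ε ^ (1 / (2 * (d : ℝ))))) (𝓝 0)
        (𝓝 (√((0:ℝ) ^ (1 / (2 * (d : ℝ)))))) :=
      (Real.continuous_sqrt.comp (Real.continuous_rpow_const hd0.le)).tendsto 0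
    rw [Real.zero_rpow hd0.ne', Real.sqrt_zero] at h1
    exact h1.mono_left nhdsWithin_le_nhds
  refine ⟨fun f hf hM => ?_, moment_part hd μ hmom hδ hs,
    energy_part hd hp1 hp2 hq1 hq2 hφ μ hmom hδ hs he0 he⟩
  obtain ⟨M, hM⟩ := hM
  exact weak_part hd μ hδ hs hf hM
end
end

section
/- For every μ ∈ P_2(ℝ^d), the heat-kernel regularized energies converge to the energy: lim_{ε→0} ∬_{ℝ^d×ℝ^d} (ψ_ε * K * ψ_ε)(x−y) dμ(x) dμ(y) = E(μ), where ψ_ε is the heat kernel. -/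
open MeasureTheory Filter
open scoped ENNReal Topology NNReal

noncomputable section

section HeatAux

variable {d : ℕ}

lemma gauss_lintegral (b : ℝ) (hb : 0 < b) (c : EuclideanSpace ℝ (Fin d)) :
    ∫⁻ y : EuclideanSpace ℝ (Fin d), ENNReal.ofReal (Real.exp (-b * ‖y - c‖ ^ 2)) =
      ENNReal.ofReal ((Real.pi / b) ^ ((d : ℝ) / 2)) := by
  rw [lintegral_sub_right_eq_self
    (fun y : EuclideanSpace ℝ (Fin d) => ENNReal.ofReal (Real.exp (-b * ‖y‖ ^ 2))) c]
  have h := GaussianFourier.integral_rexp_neg_mul_sq_norm (V := EuclideanSpace ℝ (Fin d)) hb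
  rw [finrank_euclideanSpace, Fintype.card_fin] at h
  have hpos : 0 < (Real.pi / b) ^ ((d : ℝ) / 2) := by positivity
  have hi : Integrable (fun v : EuclideanSpace ℝ (Fin d) => Real.exp (-b * ‖v‖ ^ 2)) := by
    apply Integrable.of_integral_ne_zero
    rw [h]; exact hpos.ne'
  rw [← h, ofReal_integral_eq_lintegral_ofReal hi (ae_of_all _ fun _ => (Real.exp_pos _).le)]

lemma gamma_lintegral (s a : ℝ) (hs : 0 < s) (ha : 0 < a) :
    ∫⁻ t in Set.Ioi (0 : ℝ), ENNReal.ofReal (t ^ (s - 1) * Real.exp (-(a * t))) =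
      ENNReal.ofReal ((1 / a) ^ s * Real.Gamma s) := by
  have h := Real.integral_rpow_mul_exp_neg_mul_Ioi hs ha
  have hpos : 0 < (1 / a) ^ s * Real.Gamma s := by
    have := Real.Gamma_pos_of_pos hs
    positivity
  have hi : Integrable (fun t : ℝ => t ^ (s - 1) * Real.exp (-(a * t)))
      (volume.restrict (Set.Ioi 0)) := by
    apply Integrable.of_integral_ne_zero
    rw [h]; exact hpos.ne'
  rw [← h, ofReal_integral_eq_lintegral_ofReal hi]
  filter_upwards [ae_restrict_mem measurableSet_Ioi] with t ht
  have : (0:ℝ) < t := ht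
  simp only [Pi.zero_apply]
  positivity

/-- Gaussian convolved with heat kernel. -/
lemma heat_gauss (ε t : ℝ) (hε : 0 < ε) (ht : 0 < t) (x : EuclideanSpace ℝ (Fin d)) :
    ∫⁻ y : EuclideanSpace ℝ (Fin d), ENNReal.ofReal (heat d ε y) *
        ENNReal.ofReal (Real.exp (-(‖x - y‖ ^ 2 * t))) =
      ENNReal.ofReal ((1 + 4 * ε * t) ^ (-(d : ℝ) / 2) *
        Real.exp (-(‖x‖ ^ 2 * (t / (1 + 4 * ε * t))))) := by
  have hb : 0 < t + 1 / (4 * ε) := by positivity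
  have h1 : 0 < 1 + 4 * ε * t := by positivity
  have hpt : ∀ y : EuclideanSpace ℝ (Fin d), ENNReal.ofReal (heat d ε y) *
        ENNReal.ofReal (Real.exp (-(‖x - y‖ ^ 2 * t))) =
      ENNReal.ofReal ((4 * Real.pi * ε) ^ (-(d : ℝ) / 2) *
        Real.exp (-(‖x‖ ^ 2 * (t / (1 + 4 * ε * t))))) *
      ENNReal.ofReal (Real.exp (-(t + 1 / (4 * ε)) *
        ‖y - (t / (t + 1 / (4 * ε))) • x‖ ^ 2)) := by
    intro y
    have hc : 0 ≤ (4 * Real.pi * ε) ^ (-(d : ℝ) / 2) := by positivity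
    unfold heat
    rw [← ENNReal.ofReal_mul (by positivity), ← ENNReal.ofReal_mul (by positivity),
      mul_assoc (_ ^ _) (Real.exp _) (Real.exp _), mul_assoc (_ ^ _) (Real.exp _) (Real.exp _),
      ← Real.exp_add, ← Real.exp_add]
    congr 3
    rw [norm_sub_sq_real, norm_sub_sq_real, norm_smul, inner_smul_right, real_inner_comm y x,
      mul_pow, Real.norm_eq_abs, sq_abs]
    have h2 : t + 1 / (4 * ε) = (1 + 4 * ε * t) / (4 * ε) := by field_simp; ring
    rw [h2]
    field_simp
    ring
  simp_rw [hpt]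
  rw [lintegral_const_mul' _ _ ENNReal.ofReal_ne_top, gauss_lintegral _ hb,
    ← ENNReal.ofReal_mul (by positivity)]
  congr 1
  rw [mul_right_comm]
  congr 1
  have h3 : Real.pi / (t + 1 / (4 * ε)) = (4 * Real.pi * ε) / (1 + 4 * ε * t) := by
    field_simp; ring
  rw [h3, Real.div_rpow (by positivity) h1.le, neg_div, Real.rpow_neg (by positivity),
    Real.rpow_neg h1.le]
  have : (4 * Real.pi * ε) ^ ((d:ℝ)/2) ≠ 0 := by positivity
  field_simp

lemma heat_meas (ε : ℝ) : Measurable (heat d ε) := by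
  unfold heat; fun_prop

lemma heat_nonneg (ε : ℝ) (hε : 0 < ε) (x : EuclideanSpace ℝ (Fin d)) : 0 ≤ heat d ε x := by
  unfold heat; positivity

lemma heat_mass (ε : ℝ) (hε : 0 < ε) :
    ∫⁻ y : EuclideanSpace ℝ (Fin d), ENNReal.ofReal (heat d ε y) = 1 := by
  have hpt : ∀ y : EuclideanSpace ℝ (Fin d), ENNReal.ofReal (heat d ε y) =
      ENNReal.ofReal ((4 * Real.pi * ε) ^ (-(d : ℝ) / 2)) *
      ENNReal.ofReal (Real.exp (-(1 / (4 * ε)) * ‖y - 0‖ ^ 2)) := by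
    intro y
    rw [← ENNReal.ofReal_mul (by positivity)]
    unfold heat
    congr 3
    rw [sub_zero]; ring
  simp_rw [hpt]
  rw [lintegral_const_mul' _ _ ENNReal.ofReal_ne_top, gauss_lintegral _ (by positivity),
    ← ENNReal.ofReal_mul (by positivity), ← ENNReal.ofReal_one]
  congr 1
  have h3 : Real.pi / (1 / (4 * ε)) = (4 * Real.pi * ε) := by field_simp
  rw [h3, ← Real.rpow_add (by positivity)]
  simp [neg_div]

/-- One-dimensional change-of-variables inequality. -/
lemma subst_ineq (s a ε k : ℝ) (hε : 0 < ε) (hk : 1 + s ≤ k) :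
    ∫⁻ t in Set.Ioi (0 : ℝ), ENNReal.ofReal (t ^ (s - 1) * ((1 + 4 * ε * t) ^ (-k) *
        Real.exp (-(a * (t / (1 + 4 * ε * t)))))) ≤
    ∫⁻ t in Set.Ioi (0 : ℝ), ENNReal.ofReal (t ^ (s - 1) * Real.exp (-(a * t))) := by
  set S : ℝ → ℝ := fun t => t / (1 + 4 * ε * t) with hS
  have hder : ∀ t ∈ Set.Ioi (0:ℝ), HasDerivWithinAt S (1 / (1 + 4 * ε * t) ^ 2) (Set.Ioi 0) t := by
    intro t ht
    have ht' : (0:ℝ) < t := ht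
    have h1 : 0 < 1 + 4 * ε * t := by positivity
    have h2 : HasDerivAt (fun t : ℝ => 1 + 4 * ε * t) (4 * ε * 1) t :=
      ((hasDerivAt_id t).const_mul (4 * ε)).const_add 1
    have h3 : HasDerivAt S ((1 * (1 + 4 * ε * t) - t * (4 * ε * 1)) / (1 + 4 * ε * t) ^ 2) t :=
      (hasDerivAt_id t).div h2 h1.ne'
    have h4 : 1 * (1 + 4 * ε * t) - t * (4 * ε * 1) = 1 := by ring
    rw [h4] at h3
    exact h3.hasDerivWithinAt
  have hinj : Set.InjOn S (Set.Ioi 0) := by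
    intro t ht u hu h
    have ht' : (0:ℝ) < t := ht
    have hu' : (0:ℝ) < u := hu
    have h1 : 0 < 1 + 4 * ε * t := by positivity
    have h2 : 0 < 1 + 4 * ε * u := by positivity
    change t / (1 + 4 * ε * t) = u / (1 + 4 * ε * u) at h
    rw [div_eq_div_iff h1.ne' h2.ne'] at h
    linarith
  have hsub : S '' Set.Ioi 0 ⊆ Set.Ioi 0 := by
    rintro _ ⟨t, ht, rfl⟩
    have ht' : (0:ℝ) < t := ht
    show 0 < t / (1 + 4 * ε * t)
    positivity
  refine le_trans ?_ (lintegral_mono_set hsub)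
  rw [lintegral_image_eq_lintegral_abs_deriv_mul measurableSet_Ioi hder hinj]
  refine setLIntegral_mono' measurableSet_Ioi fun t ht => ?_
  have ht' : (0:ℝ) < t := ht
  have h1 : 0 < 1 + 4 * ε * t := by positivity
  rw [← ENNReal.ofReal_mul (abs_nonneg _)]
  apply ENNReal.ofReal_le_ofReal
  rw [abs_of_pos (by positivity)]
  simp only [hS]
  rw [Real.div_rpow ht'.le h1.le, ← mul_assoc, ← mul_assoc]
  refine mul_le_mul_of_nonneg_right ?_ (Real.exp_pos _).le
  have h4 : (1 + 4 * ε * t) ^ (-k) ≤ (1 + 4 * ε * t) ^ (-(1 + s)) :=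
    Real.rpow_le_rpow_of_exponent_le (by nlinarith [mul_pos hε ht']) (by linarith)
  have h5 : 1 / (1 + 4 * ε * t) ^ 2 * (t ^ (s - 1) / (1 + 4 * ε * t) ^ (s - 1)) =
      t ^ (s - 1) * (1 + 4 * ε * t) ^ (-(1 + s)) := by
    have : (1 + 4 * ε * t) ^ (-(1 + s)) = ((1 + 4 * ε * t) ^ 2 * (1 + 4 * ε * t) ^ (s - 1))⁻¹ := by
      rw [← Real.rpow_natCast, ← Real.rpow_add h1, ← Real.rpow_neg h1.le]
      congr 1; push_cast; ring
    rw [this]; field_simp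
  rw [h5]
  exact mul_le_mul_of_nonneg_left h4 (by positivity)

lemma KrE_eq (p : ℝ) (hp : p < 0) (x : EuclideanSpace ℝ (Fin d)) (hx : x ≠ 0) :
    KrE d p x = ENNReal.ofReal ((-p * Real.Gamma (-p / 2))⁻¹) *
      ∫⁻ t in Set.Ioi (0 : ℝ), ENNReal.ofReal (t ^ (-p / 2 - 1) * Real.exp (-(‖x‖ ^ 2 * t))) := by
  have hn : 0 < ‖x‖ := norm_pos_iff.2 hx
  have hG : 0 < Real.Gamma (-p / 2) := Real.Gamma_pos_of_pos (by linarith)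
  have hp' : 0 < -p := by linarith
  rw [gamma_lintegral _ _ (by linarith) (by positivity), ← ENNReal.ofReal_mul (by positivity)]
  unfold KrE
  have : (‖x‖₊ : ℝ≥0∞) = ENNReal.ofReal ‖x‖ := by
    rw [ofReal_norm]; rfl
  rw [this, ENNReal.ofReal_rpow_of_pos hn, ← ENNReal.ofReal_div_of_pos hp']
  congr 1
  rw [one_div, ← Real.rpow_natCast, ← Real.rpow_neg hn.le, ← Real.rpow_mul hn.le]
  have : (-((2:ℕ):ℝ) * (-p / 2)) = p := by push_cast; ring
  rw [this, mul_inv]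
  have := hG.ne'
  generalize Real.Gamma (-p / 2) = G at *
  field_simp

lemma KrE_meas (p : ℝ) : Measurable (KrE d p) := by
  unfold KrE; fun_prop

lemma heat_KrE_le (hd : 3 ≤ d) (p : ℝ) (hp1 : 2 - (d : ℝ) ≤ p) (hp2 : p < 0) (ε : ℝ) (hε : 0 < ε)
    (x : EuclideanSpace ℝ (Fin d)) :
    ∫⁻ y, ENNReal.ofReal (heat d ε y) * KrE d p (x - y) ≤ KrE d p x := by
  by_cases hx : x = 0
  · have : KrE d p x = ⊤ := by
      subst hx
      simp [KrE, ENNReal.zero_rpow_of_neg hp2, ENNReal.top_div]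
    rw [this]; exact le_top
  have : Nonempty (Fin d) := ⟨⟨0, by omega⟩⟩
  have : Nontrivial (EuclideanSpace ℝ (Fin d)) := inferInstance
  set C := ENNReal.ofReal ((-p * Real.Gamma (-p / 2))⁻¹) with hC
  have hCt : C ≠ ⊤ := ENNReal.ofReal_ne_top
  calc ∫⁻ y, ENNReal.ofReal (heat d ε y) * KrE d p (x - y)
      = ∫⁻ y, C * ∫⁻ t in Set.Ioi (0 : ℝ), ENNReal.ofReal (heat d ε y) *
          ENNReal.ofReal (t ^ (-p / 2 - 1) * Real.exp (-(‖x - y‖ ^ 2 * t))) := by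
        apply lintegral_congr_ae
        have : ∀ᵐ y : EuclideanSpace ℝ (Fin d), y ≠ x := by
          simp [ae_iff]
        filter_upwards [this] with y hy
        rw [KrE_eq p hp2 _ (sub_ne_zero.2 hy.symm), lintegral_const_mul' _ _ ENNReal.ofReal_ne_top]
        ring
    _ = C * ∫⁻ t in Set.Ioi (0 : ℝ), ∫⁻ y, ENNReal.ofReal (heat d ε y) *
          ENNReal.ofReal (t ^ (-p / 2 - 1) * Real.exp (-(‖x - y‖ ^ 2 * t))) := by
        rw [lintegral_const_mul' _ _ hCt]
        congr 1
        apply lintegral_lintegral_swap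
        have := heat_meas (d := d) ε
        apply Measurable.aemeasurable
        fun_prop
    _ = C * ∫⁻ t in Set.Ioi (0 : ℝ), ENNReal.ofReal (t ^ (-p / 2 - 1) *
          ((1 + 4 * ε * t) ^ (-((d : ℝ) / 2)) *
            Real.exp (-(‖x‖ ^ 2 * (t / (1 + 4 * ε * t)))))) := by
        congr 1
        refine setLIntegral_congr_fun measurableSet_Ioi fun t ht => ?_
        have ht' : (0:ℝ) < t := ht
        have h0 : 0 ≤ t ^ (-p / 2 - 1) := by positivity
        simp_rw [ENNReal.ofReal_mul h0, mul_left_comm _ (ENNReal.ofReal (t ^ (-p / 2 - 1)))]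
        rw [lintegral_const_mul' _ _ ENNReal.ofReal_ne_top, heat_gauss ε t hε ht', neg_div (2:ℝ) (d:ℝ)]
    _ ≤ KrE d p x := by
        rw [KrE_eq p hp2 x hx]
        refine mul_le_mul' le_rfl ?_
        exact subst_ineq _ _ _ _ hε (by linarith)

lemma convE_KrE_le (hd : 3 ≤ d) (p : ℝ) (hp1 : 2 - (d : ℝ) ≤ p) (hp2 : p < 0) (ε : ℝ) (hε : 0 < ε)
    (x : EuclideanSpace ℝ (Fin d)) :
    convE d (heat d ε) (KrE d p) x ≤ KrE d p x := by
  unfold convE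
  calc _ = ∫⁻ y, ENNReal.ofReal (heat d ε y) *
        ∫⁻ z, ENNReal.ofReal (heat d ε z) * KrE d p ((x - y) - z) := by
        apply lintegral_congr; intro y
        rw [← lintegral_const_mul' _ _ ENNReal.ofReal_ne_top]
        apply lintegral_congr; intro z
        ring
    _ ≤ ∫⁻ y, ENNReal.ofReal (heat d ε y) * KrE d p (x - y) := by
        gcongr with y
        exact heat_KrE_le hd p hp1 hp2 ε hε _
    _ ≤ _ := heat_KrE_le hd p hp1 hp2 ε hε _

/-- Standard Gaussian measure with density `heat d 1`. -/
def gam (d : ℕ) : Measure (EuclideanSpace ℝ (Fin d)) :=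
  volume.withDensity fun u => ENNReal.ofReal (heat d 1 u)

lemma gam_lintegral (F : EuclideanSpace ℝ (Fin d) → ℝ≥0∞) (hF : Measurable F) :
    ∫⁻ u, F u ∂(gam d) = ∫⁻ u, ENNReal.ofReal (heat d 1 u) * F u := by
  unfold gam
  rw [lintegral_withDensity_eq_lintegral_mul _ (heat_meas 1).ennreal_ofReal hF]
  rfl

instance gam_prob : IsProbabilityMeasure (gam d) := by
  constructor
  rw [← lintegral_one, gam_lintegral _ measurable_const]
  simpa using heat_mass (d := d) 1 one_pos

lemma heat_scale (ε : ℝ) (hε : 0 < ε) (F : EuclideanSpace ℝ (Fin d) → ℝ≥0∞) (hF : Measurable F) :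
    ∫⁻ y, ENNReal.ofReal (heat d ε y) * F y = ∫⁻ u, F (√ε • u) ∂(gam d) := by
  have hs : 0 < √ε := Real.sqrt_pos.2 hε
  rw [gam_lintegral _ (by fun_prop)]
  have hpt : ∀ u : EuclideanSpace ℝ (Fin d), ENNReal.ofReal (heat d 1 u) * F (√ε • u) =
      (fun y => ENNReal.ofReal (√ε ^ d) * (ENNReal.ofReal (heat d ε y) * F y)) (√ε • u) := by
    intro u
    simp only
    rw [← mul_assoc, ← ENNReal.ofReal_mul (by positivity)]
    congr 2
    unfold heat
    rw [norm_smul, mul_pow, Real.norm_eq_abs, sq_abs, Real.sq_sqrt hε.le, ← mul_assoc]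
    congr 1
    · rw [Real.mul_rpow (by positivity) hε.le, mul_one, Real.sqrt_eq_rpow, ← Real.rpow_natCast,
        ← Real.rpow_mul hε.le, mul_left_comm, ← Real.rpow_add hε]
      have : (1 / 2 * (d:ℝ) + -(d:ℝ) / 2) = 0 := by ring
      rw [this]; simp
    · congr 1
      field_simp
  simp_rw [hpt]
  have hm := heat_meas (d := d) ε
  rw [← lintegral_map (μ := volume)
    (f := fun y => ENNReal.ofReal (√ε ^ d) * (ENNReal.ofReal (heat d ε y) * F y))
    (g := fun u => √ε • u) (by fun_prop) (by fun_prop),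
    Measure.map_addHaar_smul _ hs.ne', lintegral_smul_measure,
    lintegral_const_mul' _ _ ENNReal.ofReal_ne_top, finrank_euclideanSpace, Fintype.card_fin,
    smul_eq_mul, ← mul_assoc, ← ENNReal.ofReal_mul (by positivity), abs_of_pos (by positivity),
    inv_mul_cancel₀ (by positivity)]
  simp

lemma convE_eq (ε : ℝ) (hε : 0 < ε) (K : EuclideanSpace ℝ (Fin d) → ℝ≥0∞) (hK : Measurable K)
    (x : EuclideanSpace ℝ (Fin d)) :
    convE d (heat d ε) K x = ∫⁻ u, ∫⁻ v, K (x - √ε • u - √ε • v) ∂(gam d) ∂(gam d) := by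
  unfold convE
  calc _ = ∫⁻ y, ENNReal.ofReal (heat d ε y) *
        ∫⁻ z, ENNReal.ofReal (heat d ε z) * K ((x - y) - z) := by
        apply lintegral_congr; intro y
        rw [← lintegral_const_mul' _ _ ENNReal.ofReal_ne_top]
        apply lintegral_congr; intro z
        ring
    _ = ∫⁻ y, ENNReal.ofReal (heat d ε y) * ∫⁻ v, K (x - y - √ε • v) ∂(gam d) := by
        apply lintegral_congr; intro y
        rw [heat_scale ε hε (fun z => K (x - y - z)) (by fun_prop)]
    _ = _ := by
        rw [heat_scale ε hε (fun y => ∫⁻ v, K (x - y - √ε • v) ∂(gam d))]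
        apply Measurable.lintegral_prod_right' (ν := gam d)
          (f := fun z : EuclideanSpace ℝ (Fin d) × EuclideanSpace ℝ (Fin d) => K (x - z.1 - √ε • z.2))
        fun_prop

/-- The product measure on which everything lives. -/
def bigP (d : ℕ) (μ : Measure (EuclideanSpace ℝ (Fin d))) :
    Measure ((EuclideanSpace ℝ (Fin d) × EuclideanSpace ℝ (Fin d)) ×
      (EuclideanSpace ℝ (Fin d) × EuclideanSpace ℝ (Fin d))) :=
  (μ.prod μ).prod ((gam d).prod (gam d))

lemma bigP_lintegral (μ : Measure (EuclideanSpace ℝ (Fin d))) [IsProbabilityMeasure μ]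
    (F : (EuclideanSpace ℝ (Fin d) × EuclideanSpace ℝ (Fin d)) ×
      (EuclideanSpace ℝ (Fin d) × EuclideanSpace ℝ (Fin d)) → ℝ≥0∞) (hF : Measurable F) :
    ∫⁻ w, F w ∂(bigP d μ) =
      ∫⁻ x, ∫⁻ y, ∫⁻ u, ∫⁻ v, F ((x, y), (u, v)) ∂(gam d) ∂(gam d) ∂μ ∂μ := by
  unfold bigP
  rw [lintegral_prod _ hF.aemeasurable, lintegral_prod _ (hF.lintegral_prod_right').aemeasurable]
  apply lintegral_congr; intro x
  apply lintegral_congr; intro y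
  rw [lintegral_prod]
  apply Measurable.aemeasurable
  fun_prop

lemma energy_eq_s12 (μ : Measure (EuclideanSpace ℝ (Fin d))) [IsProbabilityMeasure μ]
    (ε : ℝ) (hε : 0 < ε) (K : EuclideanSpace ℝ (Fin d) → ℝ≥0∞) (hK : Measurable K) :
    energyE d (convE d (heat d ε) K) μ =
      ∫⁻ w, K (w.1.1 - w.1.2 - √ε • w.2.1 - √ε • w.2.2) ∂(bigP d μ) := by
  rw [bigP_lintegral _ _ (by fun_prop)]
  unfold energyE
  simp_rw [convE_eq ε hε K hK]

lemma energy_eq0 (μ : Measure (EuclideanSpace ℝ (Fin d))) [IsProbabilityMeasure μ]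
    (K : EuclideanSpace ℝ (Fin d) → ℝ≥0∞) (hK : Measurable K) :
    energyE d K μ = ∫⁻ w, K (w.1.1 - w.1.2) ∂(bigP d μ) := by
  rw [bigP_lintegral _ _ (by fun_prop)]
  unfold energyE
  simp

lemma K_lim (K : EuclideanSpace ℝ (Fin d) → ℝ≥0∞) (hK : Continuous K)
    (w : (EuclideanSpace ℝ (Fin d) × EuclideanSpace ℝ (Fin d)) ×
      (EuclideanSpace ℝ (Fin d) × EuclideanSpace ℝ (Fin d))) :
    Tendsto (fun ε : ℝ => K (w.1.1 - w.1.2 - √ε • w.2.1 - √ε • w.2.2)) (𝓝[>] 0)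
      (𝓝 (K (w.1.1 - w.1.2))) := by
  have : Continuous (fun ε : ℝ => K (w.1.1 - w.1.2 - √ε • w.2.1 - √ε • w.2.2)) := by
    have := Real.continuous_sqrt
    fun_prop
  have h := (this.tendsto 0).mono_left (nhdsWithin_le_nhds (s := Set.Ioi 0))
  simpa using h

lemma lower (μ : Measure (EuclideanSpace ℝ (Fin d))) [IsProbabilityMeasure μ]
    (K : EuclideanSpace ℝ (Fin d) → ℝ≥0∞) (hK : Continuous K) :
    energyE d K μ ≤ liminf (fun ε : ℝ => energyE d (convE d (heat d ε) K) μ) (𝓝[>] 0) := by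
  have hKm := hK.measurable
  have h1 : liminf (fun ε : ℝ => energyE d (convE d (heat d ε) K) μ) (𝓝[>] 0) =
      liminf (fun ε : ℝ => ∫⁻ w, K (w.1.1 - w.1.2 - √ε • w.2.1 - √ε • w.2.2) ∂(bigP d μ))
        (𝓝[>] 0) := by
    apply liminf_congr
    filter_upwards [self_mem_nhdsWithin] with ε hε
    exact energy_eq_s12 μ ε hε K hKm
  rw [h1, energy_eq0 μ K hKm]
  refine le_trans (le_of_eq ?_) (lintegral_liminf_le fun ε => by fun_prop)
  apply lintegral_congr; intro w
  exact (K_lim K hK w).liminf_eq.symm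

lemma gam_second : ∫⁻ u, (‖u‖₊ : ℝ≥0∞) ^ 2 ∂(gam d) < ⊤ := by
  rw [gam_lintegral _ (by fun_prop)]
  have hpt : ∀ u : EuclideanSpace ℝ (Fin d), ENNReal.ofReal (heat d 1 u) * (‖u‖₊ : ℝ≥0∞) ^ 2 ≤
      ENNReal.ofReal ((4 * Real.pi * 1) ^ (-(d : ℝ) / 2) * 8) *
        ENNReal.ofReal (Real.exp (-(1 / 8) * ‖u - 0‖ ^ 2)) := by
    intro u
    have : (‖u‖₊ : ℝ≥0∞) = ENNReal.ofReal ‖u‖ := by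
      rw [ofReal_norm]; rfl
    rw [this, ← ENNReal.ofReal_pow (norm_nonneg _), ← ENNReal.ofReal_mul (heat_nonneg 1 one_pos u),
      ← ENNReal.ofReal_mul (by positivity)]
    apply ENNReal.ofReal_le_ofReal
    unfold heat
    rw [mul_assoc (_ ^ _) (Real.exp _), mul_assoc (_ ^ _) 8, sub_zero]
    refine mul_le_mul_of_nonneg_left ?_ (by positivity)
    have h1 : ‖u‖ ^ 2 ≤ 8 * Real.exp (‖u‖ ^ 2 / 8) := by
      have := Real.add_one_le_exp (‖u‖ ^ 2 / 8)
      linarith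
    calc Real.exp (-‖u‖ ^ 2 / (4 * 1)) * ‖u‖ ^ 2
        ≤ Real.exp (-‖u‖ ^ 2 / (4 * 1)) * (8 * Real.exp (‖u‖ ^ 2 / 8)) := by gcongr
      _ = 8 * Real.exp (-(1 / 8) * ‖u‖ ^ 2) := by
        rw [mul_left_comm, ← Real.exp_add]; congr 2; ring
  refine lt_of_le_of_lt (lintegral_mono hpt) ?_
  rw [lintegral_const_mul' _ _ ENNReal.ofReal_ne_top, gauss_lintegral _ (by norm_num)]
  exact ENNReal.mul_lt_top ENNReal.ofReal_lt_top ENNReal.ofReal_lt_top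

/-- Attractive part. -/
def KaE (d : ℕ) (q : ℝ) (x : EuclideanSpace ℝ (Fin d)) : ℝ≥0∞ :=
  (‖x‖₊ : ℝ≥0∞) ^ q / ENNReal.ofReal q

lemma KaE_cont (q : ℝ) (hq : 0 < q) : Continuous (KaE d q) := by
  unfold KaE
  have h : ENNReal.ofReal q ≠ 0 := by simpa using hq
  exact (ENNReal.continuous_div_const _ h).comp
    ((ENNReal.continuous_rpow_const).comp (ENNReal.continuous_coe.comp continuous_nnnorm))

lemma KrE_cont (p : ℝ) (hp : p < 0) : Continuous (KrE d p) := by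
  unfold KrE
  have h : ENNReal.ofReal (-p) ≠ 0 := by simpa using hp
  exact (ENNReal.continuous_div_const _ h).comp
    ((ENNReal.continuous_rpow_const).comp (ENNReal.continuous_coe.comp continuous_nnnorm))

lemma rpow_le_quad (q : ℝ) (hq1 : 0 < q) (hq2 : q ≤ 2) (s : ℝ) (hs0 : 0 < s) (hs1 : s ≤ 1)
    (x y u v : EuclideanSpace ℝ (Fin d)) :
    (‖x - y - √s • u - √s • v‖₊ : ℝ≥0∞) ^ q ≤
      1 + 4 * ((‖x‖₊ : ℝ≥0∞) ^ 2 + (‖y‖₊ : ℝ≥0∞) ^ 2 + (‖u‖₊ : ℝ≥0∞) ^ 2 + (‖v‖₊ : ℝ≥0∞) ^ 2) := by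
  rw [← ENNReal.coe_rpow_of_nonneg _ hq1.le]
  norm_cast
  rw [← NNReal.coe_le_coe]
  push_cast
  have hn : ‖x - y - √s • u - √s • v‖ ≤ ‖x‖ + ‖y‖ + ‖u‖ + ‖v‖ := by
    have hq : √s ≤ 1 := Real.sqrt_le_one.2 hs1
    have h0 := Real.sqrt_nonneg s
    have hu : ‖√s • u‖ ≤ ‖u‖ := by
      rw [norm_smul, Real.norm_of_nonneg h0]; exact mul_le_of_le_one_left (norm_nonneg _) hq
    have hv : ‖√s • v‖ ≤ ‖v‖ := by
      rw [norm_smul, Real.norm_of_nonneg h0]; exact mul_le_of_le_one_left (norm_nonneg _) hq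
    have := norm_sub_le (x - y - √s • u) (√s • v)
    have := norm_sub_le (x - y) (√s • u)
    have := norm_sub_le x y
    linarith
  set N := ‖x - y - √s • u - √s • v‖
  have hN : 0 ≤ N := norm_nonneg _
  have h1 : N ^ q ≤ 1 + N ^ 2 := by
    by_cases h : N ≤ 1
    · have := Real.rpow_le_one hN h hq1.le
      nlinarith
    · have := Real.rpow_le_rpow_of_exponent_le (not_le.1 h).le hq2
      rw [Real.rpow_two] at this
      linarith
  have h2 : N ^ 2 ≤ (‖x‖ + ‖y‖ + ‖u‖ + ‖v‖) ^ 2 := by gcongr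
  nlinarith [sq_nonneg (‖x‖ - ‖y‖), sq_nonneg (‖x‖ - ‖u‖), sq_nonneg (‖x‖ - ‖v‖),
    sq_nonneg (‖y‖ - ‖u‖), sq_nonneg (‖y‖ - ‖v‖), sq_nonneg (‖u‖ - ‖v‖)]

lemma attr_tendsto (q : ℝ) (hq1 : 0 < q) (hq2 : q ≤ 2)
    (μ : Measure (EuclideanSpace ℝ (Fin d))) [IsProbabilityMeasure μ]
    (hμ : (∫⁻ x, (‖x‖₊ : ℝ≥0∞) ^ 2 ∂μ) < ⊤) :
    Tendsto (fun ε : ℝ => energyE d (convE d (heat d ε) (KaE d q)) μ)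
      (𝓝[>] 0) (𝓝 (energyE d (KaE d q) μ)) := by
  have hKm := (KaE_cont (d := d) q hq1).measurable
  have hev : (fun ε : ℝ => ∫⁻ w, KaE d q (w.1.1 - w.1.2 - √ε • w.2.1 - √ε • w.2.2) ∂(bigP d μ))
      =ᶠ[𝓝[>] 0] (fun ε : ℝ => energyE d (convE d (heat d ε) (KaE d q)) μ) := by
    filter_upwards [self_mem_nhdsWithin] with ε hε
    exact (energy_eq_s12 μ ε hε _ hKm).symm
  refine Tendsto.congr' hev ?_
  rw [energy_eq0 μ _ hKm]
  have h : ENNReal.ofReal q ≠ 0 := by simpa using hq1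
  refine tendsto_lintegral_filter_of_dominated_convergence
    (fun w => (1 + 4 * ((‖w.1.1‖₊ : ℝ≥0∞) ^ 2 + (‖w.1.2‖₊ : ℝ≥0∞) ^ 2 + (‖w.2.1‖₊ : ℝ≥0∞) ^ 2 +
      (‖w.2.2‖₊ : ℝ≥0∞) ^ 2)) / ENNReal.ofReal q) ?_ ?_ ?_ ?_
  · exact Eventually.of_forall fun ε => by fun_prop
  · filter_upwards [Ioc_mem_nhdsGT (zero_lt_one' ℝ)] with ε hε
    refine ae_of_all _ fun w => ?_
    unfold KaE
    gcongr
    exact rpow_le_quad q hq1 hq2 ε hε.1 hε.2 _ _ _ _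
  · simp_rw [div_eq_mul_inv]
    rw [lintegral_mul_const' _ _ (ENNReal.inv_ne_top.2 h)]
    refine ENNReal.mul_ne_top ?_ (ENNReal.inv_ne_top.2 h)
    have hg := gam_second (d := d)
    rw [bigP_lintegral _ _ (by fun_prop)]
    have hm : ∀ ν : Measure (EuclideanSpace ℝ (Fin d)), IsProbabilityMeasure ν → ∀ a : ℝ≥0∞,
        ∀ g : EuclideanSpace ℝ (Fin d) → ℝ≥0∞,
        ∫⁻ x, (a + g x) ∂ν = a + ∫⁻ x, g x ∂ν := by
      intro ν hν a g
      rw [lintegral_add_left measurable_const]; simp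
    have e : ∀ x y u v : EuclideanSpace ℝ (Fin d), (1 + 4 * ((‖x‖₊ : ℝ≥0∞) ^ 2 + (‖y‖₊ : ℝ≥0∞) ^ 2
        + (‖u‖₊ : ℝ≥0∞) ^ 2 + (‖v‖₊ : ℝ≥0∞) ^ 2)) =
        1 + (4 * (‖x‖₊ : ℝ≥0∞) ^ 2 + (4 * (‖y‖₊ : ℝ≥0∞) ^ 2 +
          (4 * (‖u‖₊ : ℝ≥0∞) ^ 2 + 4 * (‖v‖₊ : ℝ≥0∞) ^ 2))) := by
      intros; ring
    have h4 : (4 : ℝ≥0∞) ≠ ⊤ := by norm_num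
    have hadd : ∀ ν : Measure (EuclideanSpace ℝ (Fin d)), IsProbabilityMeasure ν → ∀ a : ℝ≥0∞,
        ∫⁻ x, (4 * (‖x‖₊ : ℝ≥0∞) ^ 2 + a) ∂ν = 4 * (∫⁻ x, (‖x‖₊ : ℝ≥0∞) ^ 2 ∂ν) + a := by
      intro ν hν a
      rw [lintegral_add_right _ measurable_const, lintegral_const_mul' _ _ h4]; simp
    simp only [e, hm _ inferInstance, hadd _ inferInstance, lintegral_const_mul' _ _ h4]
    finiteness
  · exact ae_of_all _ fun w => K_lim _ (KaE_cont q hq1) w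

lemma energy_conv_add (μ : Measure (EuclideanSpace ℝ (Fin d))) [IsProbabilityMeasure μ]
    (ε : ℝ) (hε : 0 < ε) (K L : EuclideanSpace ℝ (Fin d) → ℝ≥0∞) (hK : Measurable K)
    (hL : Measurable L) :
    energyE d (convE d (heat d ε) (fun x => K x + L x)) μ =
      energyE d (convE d (heat d ε) K) μ + energyE d (convE d (heat d ε) L) μ := by
  rw [energy_eq_s12 μ ε hε _ (by fun_prop), energy_eq_s12 μ ε hε _ hK, energy_eq_s12 μ ε hε _ hL,
    lintegral_add_left (by fun_prop)]

lemma energy_add (μ : Measure (EuclideanSpace ℝ (Fin d))) [IsProbabilityMeasure μ]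
    (K L : EuclideanSpace ℝ (Fin d) → ℝ≥0∞) (hK : Measurable K)
    (hL : Measurable L) :
    energyE d (fun x => K x + L x) μ = energyE d K μ + energyE d L μ := by
  rw [energy_eq0 μ _ (by fun_prop), energy_eq0 μ _ hK, energy_eq0 μ _ hL,
    lintegral_add_left (by fun_prop)]

lemma rep_tendsto (hd : 3 ≤ d) (p : ℝ) (hp1 : 2 - (d : ℝ) ≤ p) (hp2 : p < 0)
    (μ : Measure (EuclideanSpace ℝ (Fin d))) [IsProbabilityMeasure μ] :
    Tendsto (fun ε : ℝ => energyE d (convE d (heat d ε) (KrE d p)) μ)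
      (𝓝[>] 0) (𝓝 (energyE d (KrE d p) μ)) := by
  refine tendsto_of_le_liminf_of_limsup_le (lower μ _ (KrE_cont p hp2)) ?_
  refine limsup_le_of_le (by isBoundedDefault) ?_
  filter_upwards [self_mem_nhdsWithin] with ε hε
  unfold energyE
  exact lintegral_mono fun x => lintegral_mono fun y => convE_KrE_le hd p hp1 hp2 ε hε _

end HeatAux

/-- The heat-kernel regularized energies converge to the energy:
`lim_{ε→0} ∬ (ψ_ε * K * ψ_ε)(x-y) dμ(x)dμ(y) = E(μ)` for every `μ ∈ P₂(ℝ^d)`. -/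
theorem heat_regularized_energy_tendsto
    (d : ℕ) (hd : 3 ≤ d) (p q : ℝ) (hp1 : 2 - (d : ℝ) ≤ p) (hp2 : p < 0)
    (hq1 : 0 < q) (hq2 : q ≤ 2)
    (μ : Measure (EuclideanSpace ℝ (Fin d))) (hμ : IsP2 d μ) :
    Tendsto (fun ε : ℝ => energyE d (convE d (heat d ε) (KE d p q)) μ)
      (𝓝[>] 0) (𝓝 (energyE d (KE d p q) μ)) := by
  have := hμ.1
  have hKE : KE d p q = fun x => KaE d q x + KrE d p x := rfl
  have ha := (KaE_cont (d := d) q hq1).measurable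
  have hr := (KrE_cont (d := d) p hp2).measurable
  rw [hKE, energy_add μ _ _ ha hr]
  refine Tendsto.congr' ?_
    ((attr_tendsto q hq1 hq2 μ hμ.2).add (rep_tendsto hd p hp1 hp2 μ))
  filter_upwards [self_mem_nhdsWithin] with ε hε
  exact (energy_conv_add μ ε hε _ _ ha hr).symm
end
end
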